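/- arXiv:2106.08986 — 5 statements merged into one kernel-verified Lean document; each statement's English description precedes it below -/
import Mathlib

section
/- Let q be an odd prime power and let 2 ≤ m < k be integers. Let L be an irredundant (m×k)-system over F_q. If L induces some (2×4)-system as a subsystem, then L is uncommon. -/
open Finset

section Defs

variable {F : Type} [Field F] [Fintype F] [DecidableEq F]

/-- The set of solutions to `L x = 0` with all coordinates in `A ⊆ F^n`. -/
def solSet {m k n : ℕ} (L : Matrix (Fin m) (Fin k) F) (A : Set (Fin n → F)) :
    Set (Fin k → Fin n → F) :=
  {x | (∀ j, x j ∈ A) ∧ ∀ i, ∑ j, L i j • x j = 0}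

/-- The finset of all solutions to `L x = 0` over `F^n`. -/
def solutions {m k : ℕ} (L : Matrix (Fin m) (Fin k) F) (n : ℕ) :
    Finset (Fin k → Fin n → F) :=
  Finset.univ.filter fun x => ∀ i, ∑ j, L i j • x j = 0

/-- `Λ_L(f)`, the density of solutions to `L = 0` with respect to `f`. -/
noncomputable def lambdaSol {m k n : ℕ} (L : Matrix (Fin m) (Fin k) F) (f : (Fin n → F) → ℝ) : ℝ :=
  (∑ x ∈ solutions L n, ∏ j, f (x j)) / (solutions L n).card

/-- `Δ_L(f) = Λ_L(1/2 + f) + Λ_L(1/2 − f)`. -/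
noncomputable def deltaSol {m k n : ℕ} (L : Matrix (Fin m) (Fin k) F) (f : (Fin n → F) → ℝ) : ℝ :=
  lambdaSol L (fun y => 1 / 2 + f y) + lambdaSol L (fun y => 1 / 2 - f y)

/-- `L` is common: for every `n ≥ 1` and every `f : F^n → [-1/2,1/2]`,
`Δ_L(f) ≥ 2^(1-k)`. -/
def IsCommon {m k : ℕ} (L : Matrix (Fin m) (Fin k) F) : Prop :=
  ∀ n : ℕ, 1 ≤ n → ∀ f : (Fin n → F) → ℝ,
    (∀ y, f y ∈ Set.Icc (-(1 / 2) : ℝ) (1 / 2)) →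
    (2 : ℝ) ^ (1 - (k : ℤ)) ≤ deltaSol L f

/-- The rows of the coefficient matrix `L` are linearly independent. -/
def RowsIndep {m k : ℕ} (L : Matrix (Fin m) (Fin k) F) : Prop :=
  LinearIndependent F fun i => fun j => L i j

/-- `L` induces the `ℓ`-variable system `L'` on the set `B` (with `B` listed in
increasing order). -/
def InducesOn {m k m' ℓ : ℕ} (L : Matrix (Fin m) (Fin k) F)
    (L' : Matrix (Fin m') (Fin ℓ) F) (B : Finset (Fin k)) (hB : B.card = ℓ) : Prop :=
  ∀ x : Fin k → F, (∀ i, ∑ j, L i j * x j = 0) →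
    ∀ r, ∑ t, L' r t * x (B.orderIsoOfFin hB t).1 = 0

/-- `L` is irredundant: it does not induce the equation `x i − x j = 0` for any `i ≠ j`. -/
def IsIrredundant {m k : ℕ} (L : Matrix (Fin m) (Fin k) F) : Prop :=
  ¬ ∃ i j : Fin k, i ≠ j ∧
    ∀ x : Fin k → F, (∀ r, ∑ t, L r t * x t = 0) → x i = x j

/-- `c` is a (single) linear equation induced by `L`. -/
def InducedEq {m k : ℕ} (L : Matrix (Fin m) (Fin k) F) (c : Fin k → F) : Prop :=
  ∀ x : Fin k → F, (∀ i, ∑ j, L i j * x j = 0) → ∑ j, c j * x j = 0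

/-- Length of an equation: the number of variables with nonzero coefficient. -/
def eqLength {k : ℕ} (c : Fin k → F) : ℕ := (Finset.univ.filter fun j => c j ≠ 0).card

/-- `s(L)`: the minimal length of a nonzero equation induced by `L`. -/
noncomputable def sMin {m k : ℕ} (L : Matrix (Fin m) (Fin k) F) : ℕ :=
  sInf {s | ∃ c : Fin k → F, c ≠ 0 ∧ InducedEq L c ∧ eqLength c = s}

/-- `c(L)`: `s(L)` rounded up to the nearest even number. -/
noncomputable def cEven {m k : ℕ} (L : Matrix (Fin m) (Fin k) F) : ℕ :=
  if Even (sMin L) then sMin L else sMin L + 1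

/-- `B` is a critical set for `L`: `|B| = c(L)` and `L` induces some system on `B`. -/
def IsCriticalSet {m k : ℕ} (L : Matrix (Fin m) (Fin k) F) (B : Finset (Fin k)) : Prop :=
  B.card = cEven L ∧ ∃ (m' : ℕ) (L' : Matrix (Fin m') (Fin B.card) F),
    1 ≤ m' ∧ RowsIndep L' ∧ InducesOn L L' B rfl

/-- `m_B`: the maximal `m'` such that `L` induces an `(m' × |B|)`-system on `B`. -/
noncomputable def mMax {m k : ℕ} (L : Matrix (Fin m) (Fin k) F) (B : Finset (Fin k)) : ℕ :=
  sSup {m' | ∃ L' : Matrix (Fin m') (Fin B.card) F, RowsIndep L' ∧ InducesOn L L' B rfl}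

/-- `Φ_L(B, f)`. -/
noncomputable def Phi {m k n : ℕ} (L : Matrix (Fin m) (Fin k) F) (B : Finset (Fin k))
    (f : (Fin n → F) → ℝ) : ℝ :=
  (∑ x ∈ solutions L n, ∏ j ∈ B, f (x j)) / (solutions L n).card

/-- `B` is rank-reducing for `L`: deleting the columns indexed by `B` decreases the rank. -/
def RankReducing {m k : ℕ} (L : Matrix (Fin m) (Fin k) F) (B : Finset (Fin k)) : Prop :=
  (L.submatrix id fun j : {j : Fin k // j ∉ B} => (j : Fin k)).rank < L.rank

end Defs

open Filter Topology in
/-- If the polynomial `ε ↦ Δ_L(ε g)` has a negative first nonconstant coefficient, `L` is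
uncommon. -/
theorem not_isCommon_of_sum_Phi_neg {F : Type} [Field F] [Fintype F] [DecidableEq F]
    {m k n : ℕ} (L : Matrix (Fin m) (Fin k) F) (hn : 1 ≤ n) (g : (Fin n → F) → ℝ)
    {r : ℕ} (hr : Even r) (hr0 : r ≠ 0)
    (hzero : ∀ j, Even j → 0 < j → j < r → ∑ B ∈ powersetCard j univ, Phi L B g = 0)
    (hneg : ∑ B ∈ powersetCard r univ, Phi L B g < 0) : ¬ IsCommon L := by
  intro hcommon
  set Q : ℕ → ℝ := fun j => ∑ B ∈ powersetCard j univ, Phi L B g with hQ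
  set a : ℕ → ℝ := fun j => (1 / 2) ^ (k - j) * (1 + (-1) ^ j) * Q j with ha
  have hrk : r ≤ k := by
    by_contra h
    rw [Finset.powersetCard_eq_empty.2 (by simpa using h)] at hneg
    simp at hneg
  have hS : ((solutions L n).card : ℝ) ≠ 0 := by
    have : (0 : Fin k → Fin n → F) ∈ solutions L n := by simp [solutions]
    exact_mod_cast (Finset.card_pos.2 ⟨_, this⟩).ne'
  have hexp : ∀ ε : ℝ, deltaSol L (fun y => ε * g y) = ∑ j ∈ range (k + 1), a j * ε ^ j := by
    intro ε
    have h1 : ∀ σ : ℝ, lambdaSol L (fun y => 1 / 2 + σ * g y) =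
        ∑ B ∈ (univ : Finset (Fin k)).powerset,
          (1 / 2) ^ (k - B.card) * σ ^ B.card * Phi L B g := by
      intro σ
      unfold lambdaSol Phi
      rw [div_eq_iff hS, Finset.sum_mul]
      have h2 : ∀ x : Fin k → Fin n → F, ∏ j, (1 / 2 + σ * g (x j)) =
          ∑ B ∈ (univ : Finset (Fin k)).powerset,
            (1 / 2) ^ (k - B.card) * σ ^ B.card * ∏ j ∈ B, g (x j) := by
        intro x
        simp_rw [add_comm (1 / 2 : ℝ)]
        rw [Finset.prod_add]
        refine Finset.sum_congr rfl fun B _ => ?_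
        rw [Finset.prod_mul_distrib, Finset.prod_const, Finset.prod_const,
          Finset.card_sdiff_of_subset (Finset.subset_univ B)]
        simp only [Finset.card_univ, Fintype.card_fin]
        ring
      simp_rw [h2]
      rw [Finset.sum_comm]
      refine Finset.sum_congr rfl fun B _ => ?_
      rw [← Finset.mul_sum]
      field_simp
    have h3 : deltaSol L (fun y => ε * g y) =
        lambdaSol L (fun y => 1 / 2 + ε * g y) + lambdaSol L (fun y => 1 / 2 + (-ε) * g y) := by
      simp only [deltaSol, sub_eq_add_neg, neg_mul]
    rw [h3, h1, h1, ← Finset.sum_add_distrib, Finset.sum_powerset]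
    simp only [Finset.card_univ, Fintype.card_fin]
    refine Finset.sum_congr rfl fun j _ => ?_
    simp only [ha, hQ, Finset.mul_sum, Finset.sum_mul]
    refine Finset.sum_congr rfl fun B hB => ?_
    rw [(Finset.mem_powersetCard.1 hB).2, neg_pow ε]
    ring
  have ha0 : a 0 = 2 ^ (1 - (k : ℤ)) := by
    have : Q 0 = 1 := by simp [hQ, Phi, hS]
    simp only [ha, this]
    rw [zpow_sub₀ (by norm_num)]
    simp
    ring
  have haz : ∀ j, j ≠ 0 → j < r → a j = 0 := by
    intro j hj hjr
    rcases Nat.even_or_odd j with he | ho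
    · have : Q j = 0 := hzero j he (Nat.pos_of_ne_zero hj) hjr
      simp [ha, this]
    · simp [ha, ho.neg_one_pow]
  have har : a r < 0 := by
    simp only [ha, hr.neg_one_pow]
    exact mul_neg_of_pos_of_neg (by positivity) hneg
  set p : ℝ → ℝ := fun ε => ∑ j ∈ range (k + 1), if j < r then 0 else a j * ε ^ (j - r) with hp
  have hfac : ∀ ε : ℝ, deltaSol L (fun y => ε * g y) = a 0 + ε ^ r * p ε := by
    intro ε
    rw [hexp, hp, Finset.mul_sum, Finset.sum_range_succ', Finset.sum_range_succ']
    simp only [Nat.pos_of_ne_zero hr0, if_true, mul_zero, add_zero, pow_zero, mul_one]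
    rw [add_comm]
    congr 1
    refine Finset.sum_congr rfl fun j _ => ?_
    split_ifs with h
    · rw [haz _ (Nat.succ_ne_zero j) h]; simp
    · rw [← Nat.add_sub_of_le (not_lt.1 h), pow_add, Nat.add_sub_cancel_left]
      ring
  have hp0 : p 0 < 0 := by
    have : p 0 = a r := by
      simp only [hp]
      rw [Finset.sum_eq_single r]
      · simp
      · intro j _ hj
        split_ifs with h
        · rfl
        · rw [zero_pow (by omega), mul_zero]
      · intro h; exact absurd (Finset.mem_range.2 (by omega)) h
    rwa [this]
  have hpc : Continuous p := by
    refine continuous_finsetSum _ fun j _ => ?_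
    split_ifs
    · exact continuous_const
    · fun_prop
  have e1 : ∀ᶠ ε in 𝓝 (0 : ℝ), p ε < 0 := hpc.continuousAt.eventually_lt_const hp0
  have e2 : ∀ᶠ ε in 𝓝 (0 : ℝ), ∀ y, ε * g y ∈ Set.Icc (-(1 / 2) : ℝ) (1 / 2) := by
    refine Filter.eventually_all.2 fun y => ?_
    have : ContinuousAt (fun ε : ℝ => ε * g y) 0 := by fun_prop
    refine this.eventually_mem (Icc_mem_nhds ?_ ?_) <;> norm_num
  have e3 : ∀ᶠ ε in 𝓝[>] (0 : ℝ), 0 < ε := eventually_mem_nhdsWithin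
  obtain ⟨ε, ⟨h1, h2⟩, h3⟩ := (((e1.and e2).filter_mono nhdsWithin_le_nhds).and e3).exists
  have := hcommon n hn _ h2
  rw [hfac, ha0] at this
  nlinarith [mul_neg_of_pos_of_neg (pow_pos h3 r) h1]

/-- The average over solutions of a function of an additive map onto `U` is its average
over `U`. -/
theorem avg_solutions_eq_avg {F : Type} [Field F] [Fintype F] [DecidableEq F] {m k n : ℕ}
    (L : Matrix (Fin m) (Fin k) F) {U : Type} [AddCommGroup U] [Fintype U] [DecidableEq U]
    (T : (Fin k → Fin n → F) →+ U) (hT : ∀ u, ∃ x ∈ solutions L n, T x = u) (H : U → ℝ) :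
    (∑ x ∈ solutions L n, H (T x)) / (solutions L n).card = (∑ u, H u) / Fintype.card U := by
  set S := solutions L n with hS
  have hadd : ∀ x ∈ S, ∀ y ∈ S, x + y ∈ S := by
    intro x hx y hy
    simp only [hS, solutions, Finset.mem_filter, Finset.mem_univ, true_and] at hx hy ⊢
    intro i
    simp only [Pi.add_apply, smul_add, Finset.sum_add_distrib, hx i, hy i, add_zero]
  have hneg : ∀ x ∈ S, -x ∈ S := by
    intro x hx
    simp only [hS, solutions, Finset.mem_filter, Finset.mem_univ, true_and] at hx ⊢
    intro i
    simp only [Pi.neg_apply, smul_neg, Finset.sum_neg_distrib, hx i, neg_zero]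
  have hfib : ∀ u, (S.filter fun x => T x = u).card = (S.filter fun x => T x = 0).card := by
    intro u
    obtain ⟨z, hz, rfl⟩ := hT u
    symm
    refine Finset.card_bij (fun x _ => x + z) ?_ ?_ ?_
    · intro x hx
      rw [Finset.mem_filter] at hx ⊢
      exact ⟨hadd _ hx.1 _ hz, by rw [map_add, hx.2, zero_add]⟩
    · intro x _ y _ h
      exact add_right_cancel h
    · intro y hy
      rw [Finset.mem_filter] at hy
      refine ⟨y + -z, ?_, by simp⟩
      rw [Finset.mem_filter]
      exact ⟨hadd _ hy.1 _ (hneg _ hz), by rw [map_add, map_neg, hy.2, add_neg_cancel]⟩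
  set N := (S.filter fun x => T x = 0).card with hN
  have hsum : ∀ G : U → ℝ, ∑ x ∈ S, G (T x) = N * ∑ u, G u := by
    intro G
    rw [← Finset.sum_fiberwise S T, Finset.mul_sum]
    refine Finset.sum_congr rfl fun u _ => ?_
    rw [Finset.sum_congr rfl (g := fun _ => G u)
      (fun x hx => by rw [(Finset.mem_filter.1 hx).2]), Finset.sum_const, hfib u, nsmul_eq_mul]
  have hcard : (S.card : ℝ) = N * Fintype.card U := by
    have := hsum fun _ => 1
    simpa using this
  have hN0 : (N : ℝ) ≠ 0 := by
    obtain ⟨z, hz, h0⟩ := hT 0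
    exact_mod_cast (Finset.card_pos.2 ⟨z, Finset.mem_filter.2 ⟨hz, h0⟩⟩).ne'
  rw [hsum, hcard, mul_div_mul_left _ _ hN0]

/-- The coordinates in `A` are free on the solution space of `L`. -/
def CoordIndep {F : Type} [Field F] {m k : ℕ} (L : Matrix (Fin m) (Fin k) F)
    (A : Finset (Fin k)) : Prop :=
  ∀ y : Fin k → F, ∃ x : Fin k → F, (∀ i, ∑ j, L i j * x j = 0) ∧ ∀ j ∈ A, x j = y j

section CoordIndep

variable {F : Type} [Field F] {m k : ℕ} {L : Matrix (Fin m) (Fin k) F}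

theorem CoordIndep.exists_eq_sum {A : Finset (Fin k)} (hA : CoordIndep L A) {c : Fin k}
    (hc : c ∉ A) (hcA : ¬ CoordIndep L (insert c A)) :
    ∃ v : Fin k → F, ∀ x : Fin k → F, (∀ i, ∑ j, L i j * x j = 0) →
      x c = ∑ a ∈ A, v a * x a := by
  classical
  choose u hu hu' using fun a : Fin k => hA (Pi.single a 1)
  have hcomb : ∀ (y : Fin k → F) (i), ∑ j, L i j * ∑ a ∈ A, y a * u a j = 0 := by
    intro y i
    simp_rw [Finset.mul_sum]
    rw [Finset.sum_comm]
    refine Finset.sum_eq_zero fun a _ => ?_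
    have := congrArg (y a * ·) (hu a i)
    simp only [Finset.mul_sum, mul_zero] at this
    rw [← this]
    exact Finset.sum_congr rfl fun j _ => by ring
  have hval : ∀ (y : Fin k → F), ∀ b ∈ A, ∑ a ∈ A, y a * u a b = y b := by
    intro y b hb
    rw [Finset.sum_eq_single b]
    · rw [hu' b b hb]; simp
    · intro a _ hab
      rw [hu' a b hb, Pi.single_eq_of_ne hab.symm, mul_zero]
    · intro h; exact absurd hb h
  refine ⟨fun a => u a c, fun x hx => ?_⟩
  by_contra hne
  apply hcA
  set z : Fin k → F := fun j => x j - ∑ a ∈ A, x a * u a j with hz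
  have hzc : z c ≠ 0 := by
    rw [hz]
    simp only [mul_comm (x _)]
    exact sub_ne_zero.2 hne
  have hzA : ∀ b ∈ A, z b = 0 := fun b hb => by simp only [hz, hval x b hb, sub_self]
  have hzS : ∀ i, ∑ j, L i j * z j = 0 := by
    intro i
    simp only [hz, mul_sub, Finset.sum_sub_distrib, hx i, hcomb x i, sub_zero]
  intro y
  set s := (y c - ∑ a ∈ A, y a * u a c) / z c with hs
  refine ⟨fun j => ∑ a ∈ A, y a * u a j + s * z j, fun i => ?_, fun j hj => ?_⟩
  · simp only [mul_add, Finset.sum_add_distrib, hcomb y i, zero_add]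
    have := congrArg (s * ·) (hzS i)
    simp only [Finset.mul_sum, mul_zero] at this
    rw [← this]
    exact Finset.sum_congr rfl fun j _ => by ring
  · rcases Finset.mem_insert.1 hj with rfl | hj
    · simp only [hs]
      field_simp
      ring
    · simp only [hval y j hj, hzA j hj, mul_zero, add_zero]

variable [Fintype F] [DecidableEq F]

theorem solutions_coord {n : ℕ} {x : Fin k → Fin n → F} (hx : x ∈ solutions L n) (l : Fin n) :
    ∀ i, ∑ j, L i j * x j l = 0 := by
  intro i
  have := congrFun ((Finset.mem_filter.1 hx).2 i) l
  simpa using this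

theorem CoordIndep.exists_solution {A : Finset (Fin k)} (hA : CoordIndep L A) {n : ℕ}
    (y : Fin k → Fin n → F) : ∃ x ∈ solutions L n, ∀ j ∈ A, x j = y j := by
  choose u hu hu' using fun l : Fin n => hA fun j => y j l
  refine ⟨fun j l => u l j, ?_, fun j hj => funext fun l => hu' l j hj⟩
  simp only [solutions, Finset.mem_filter, Finset.mem_univ, true_and]
  intro i
  ext l
  simpa using hu l i

theorem CoordIndep.Phi_eq_pow {A : Finset (Fin k)} (hA : CoordIndep L A) {n : ℕ}
    (g : (Fin n → F) → ℝ) : Phi L A g = ((∑ y, g y) / (Fintype.card F : ℝ) ^ n) ^ A.card := by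
  have h := avg_solutions_eq_avg L (n := n) (U := A → Fin n → F)
    { toFun := fun x j => x j, map_zero' := rfl, map_add' := fun _ _ => rfl }
    (fun u => by
      obtain ⟨x, hx, hxu⟩ := hA.exists_solution fun j => if h : j ∈ A then u ⟨j, h⟩ else 0
      refine ⟨x, hx, funext fun j => ?_⟩
      have := hxu j j.2
      simpa using this)
    (fun u => ∏ j, g (u j))
  simp only [AddMonoidHom.coe_mk, ZeroHom.coe_mk] at h
  rw [Phi]
  simp_rw [← Finset.prod_coe_sort A]
  rw [h, div_pow, ← Fintype.prod_sum (fun (_ : A) y => g y)]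
  simp [← pow_mul]

theorem CoordIndep.avg_single {a : Fin k} (ha : CoordIndep L {a}) {n : ℕ}
    (H : (Fin n → F) → ℝ) :
    (∑ x ∈ solutions L n, H (x a)) / (solutions L n).card =
      (∑ y, H y) / (Fintype.card F : ℝ) ^ n := by
  have h := avg_solutions_eq_avg L (n := n) (U := Fin n → F) (Pi.evalAddMonoidHom _ a)
    (fun u => by
      obtain ⟨x, hx, hxu⟩ := ha.exists_solution fun _ => u
      exact ⟨x, hx, hxu a (by simp)⟩) H
  simpa using h

theorem CoordIndep.avg_pair {a b : Fin k} (hab : a ≠ b) (h : CoordIndep L {a, b}) {n : ℕ}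
    (H : (Fin n → F) → (Fin n → F) → ℝ) :
    (∑ x ∈ solutions L n, H (x a) (x b)) / (solutions L n).card =
      (∑ y, ∑ z, H y z) / ((Fintype.card F : ℝ) ^ n) ^ 2 := by
  have h := avg_solutions_eq_avg L (n := n) (U := (Fin n → F) × (Fin n → F))
    ((Pi.evalAddMonoidHom _ a).prod (Pi.evalAddMonoidHom _ b))
    (fun u => by
      obtain ⟨x, hx, hxu⟩ := h.exists_solution fun j => if j = a then u.1 else u.2
      refine ⟨x, hx, Prod.ext ?_ ?_⟩
      · simpa using hxu a (by simp)
      · simpa [hab.symm] using hxu b (by simp))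
    (fun u => H u.1 u.2)
  simpa [Fintype.sum_prod_type, sq] using h

end CoordIndep

section AxisFun

variable {F : Type} [Field F] [DecidableEq F] {n : ℕ}

/-- The function with value `c` at the origin, `w a` at the nonzero points of the `a`-th
coordinate axis, and `0` elsewhere. -/
def axisFun (c : ℝ) (w : Fin n → ℝ) (x : Fin n → F) : ℝ :=
  if x = 0 then c else ∑ a, if x = Pi.single a (x a) then w a else 0

@[simp]
theorem axisFun_zero (c : ℝ) (w : Fin n → ℝ) : axisFun c w (0 : Fin n → F) = c := by
  simp [axisFun]

theorem axisFun_single (c : ℝ) (w : Fin n → ℝ) (a : Fin n) (s : F) :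
    axisFun c w (Pi.single a s) = if s = 0 then c else w a := by
  by_cases hs : s = 0
  · simp [hs]
  · rw [axisFun, if_neg (by simpa using hs), if_neg hs, Finset.sum_eq_single a]
    · simp
    · intro b _ hba
      rw [if_neg]
      intro h
      have := congrFun h a
      rw [Pi.single_eq_same, Pi.single_eq_of_ne hba.symm] at this
      exact hs this
    · simp

theorem exists_of_axisFun_ne_zero {c : ℝ} {w : Fin n → ℝ} {x : Fin n → F}
    (h : axisFun c w x ≠ 0) (hx : x ≠ 0) : ∃ a, ∃ s : F, s ≠ 0 ∧ x = Pi.single a s := by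
  rw [axisFun, if_neg hx] at h
  obtain ⟨a, _, ha⟩ := Finset.exists_ne_zero_of_sum_ne_zero h
  have hxa : x = Pi.single a (x a) := by
    by_contra hne
    exact ha (if_neg hne)
  refine ⟨a, x a, fun h0 => hx ?_, hxa⟩
  rw [hxa, h0, Pi.single_zero]

theorem axisFun_smul (c : ℝ) (w : Fin n → ℝ) {s : F} (hs : s ≠ 0) (x : Fin n → F) :
    axisFun c w (s • x) = axisFun c w x := by
  simp only [axisFun, smul_eq_zero, hs, false_or, Pi.smul_apply]
  congr 1
  refine Finset.sum_congr rfl fun a _ => ?_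
  have : s • x = Pi.single a (s • x a) ↔ x = Pi.single a (x a) := by
    rw [Pi.single_smul, smul_right_inj hs]
  simp only [this]

theorem axisFun_eq_zero_of_ne (c : ℝ) (w : Fin n → ℝ) {x : Fin n → F} {a b : Fin n}
    (hab : a ≠ b) (ha : x a ≠ 0) (hb : x b ≠ 0) : axisFun c w x = 0 := by
  by_contra h
  obtain ⟨d, s, _, rfl⟩ := exists_of_axisFun_ne_zero h fun h0 => ha (by simp [h0])
  have h1 : a = d := by
    by_contra hne
    exact ha (Pi.single_eq_of_ne hne _)
  have h2 : b = d := by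
    by_contra hne
    exact hb (Pi.single_eq_of_ne hne _)
  exact hab (h1.trans h2.symm)

variable [Fintype F]

theorem sum_eq_sum_axes (f : (Fin n → F) → ℝ)
    (hf : ∀ x, x ≠ 0 → (∀ a, ∀ s : F, s ≠ 0 → x ≠ Pi.single a s) → f x = 0) :
    ∑ x, f x = f 0 + ∑ a, ∑ s : Fˣ, f (Pi.single a (s : F)) := by
  have hinj : Function.Injective
      (fun o : Option (Fin n × Fˣ) => o.elim (0 : Fin n → F) fun p => Pi.single p.1 (p.2 : F)) := by
    rintro (_ | ⟨a, s⟩) (_ | ⟨b, t⟩) h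
    · rfl
    · simp [eq_comm] at h
    · simp at h
    · simp only [Option.elim_some] at h
      have h1 : a = b := by
        by_contra hne
        have := congrFun h a
        rw [Pi.single_eq_same, Pi.single_eq_of_ne hne] at this
        exact s.ne_zero this
      subst h1
      rw [Units.ext (Pi.single_injective a h)]
  rw [← Fintype.sum_of_injective _ hinj (fun o => f (o.elim 0 fun p => Pi.single p.1 (p.2 : F))) f
    ?_ fun _ => rfl]
  · simp [Fintype.sum_option, Fintype.sum_prod_type]
  · intro x hx
    refine hf x (fun h => hx ⟨none, h.symm⟩) fun a s hs h => hx ⟨some (a, Units.mk0 s hs), ?_⟩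
    simp [h]

theorem card_units_real : (Fintype.card Fˣ : ℝ) = Fintype.card F - 1 := by
  rw [Fintype.card_units, Nat.cast_sub Fintype.card_pos, Nat.cast_one]

/-- The sum of `φ ∘ axisFun`, for `φ` vanishing at `0`. -/
theorem sum_comp_axisFun (c : ℝ) (w : Fin n → ℝ) (φ : ℝ → ℝ) (hφ : φ 0 = 0) :
    ∑ x : Fin n → F, φ (axisFun c w x) = φ c + (Fintype.card F - 1) * ∑ a, φ (w a) := by
  rw [sum_eq_sum_axes]
  · simp [axisFun_single, Finset.mul_sum, card_units_real]
  · intro x hx h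
    have : axisFun c w x = 0 := by
      by_contra hne
      obtain ⟨a, s, hs, hxs⟩ := exists_of_axisFun_ne_zero hne hx
      exact h a s hs hxs
    rw [this, hφ]

/-- The count along one axis, where the three linear factors vanish at distinct points. -/
theorem sum_axis_prod (c w : ℝ) {α β γ δ s : F} (hα : α ≠ 0) (hβ : β ≠ 0) (hγ : γ ≠ 0)
    (hδ : δ ≠ 0) (hdet : α * δ - β * γ ≠ 0) (hs : s ≠ 0) :
    ∑ t : F, (if t = 0 then c else w) * (if α * s + β * t = 0 then c else w) *
      (if γ * s + δ * t = 0 then c else w) =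
      3 * c * w ^ 2 + (Fintype.card F - 3) * w ^ 3 := by
  have h1 : ∀ t, α * s + β * t = 0 ↔ t = -(α * s) / β := by
    intro t
    rw [eq_div_iff hβ, eq_neg_iff_add_eq_zero, mul_comm t, add_comm]
  have h2 : ∀ t, γ * s + δ * t = 0 ↔ t = -(γ * s) / δ := by
    intro t
    rw [eq_div_iff hδ, eq_neg_iff_add_eq_zero, mul_comm t, add_comm]
  have n1 : -(α * s) / β ≠ 0 := div_ne_zero (neg_ne_zero.2 (mul_ne_zero hα hs)) hβ
  have n2 : -(γ * s) / δ ≠ 0 := div_ne_zero (neg_ne_zero.2 (mul_ne_zero hγ hs)) hδ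
  have n3 : -(α * s) / β ≠ -(γ * s) / δ := by
    rw [Ne, div_eq_div_iff hβ hδ]
    intro h
    have : s * (α * δ - β * γ) = 0 := by linear_combination -h
    exact (mul_ne_zero hs hdet) this
  simp_rw [h1, h2]
  set p := -(α * s) / β
  set r := -(γ * s) / δ
  have key : ∀ t : F, (if t = 0 then c else w) * (if t = p then c else w) *
      (if t = r then c else w) = w ^ 3 + (c - w) * w ^ 2 *
        ((if t = 0 then 1 else 0) + (if t = p then 1 else 0) + (if t = r then 1 else 0)) := by
    intro t
    rcases eq_or_ne t 0 with rfl | h0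
    · simp only [if_true, n1.symm, n2.symm, if_false]; ring
    rcases eq_or_ne t p with rfl | hp
    · simp only [if_true, h0, n3, if_false]; ring
    simp only [h0, hp, if_false]
    split_ifs <;> ring
  simp_rw [key]
  rw [Finset.sum_add_distrib, ← Finset.mul_sum, Finset.sum_add_distrib, Finset.sum_add_distrib]
  simp only [Finset.sum_const, Finset.card_univ, Finset.sum_ite_eq', Finset.mem_univ, if_true,
    nsmul_eq_mul]
  ring

theorem sum_axisFun_quadruple (c : ℝ) (w : Fin n → ℝ) {α β γ δ : F} (hα : α ≠ 0) (hβ : β ≠ 0)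
    (hγ : γ ≠ 0) (hδ : δ ≠ 0) (hdet : α * δ - β * γ ≠ 0) :
    ∑ x : Fin n → F, ∑ y : Fin n → F, axisFun c w x * axisFun c w y *
      axisFun c w (α • x + β • y) * axisFun c w (γ • x + δ • y) =
      c ^ 4 + 4 * (Fintype.card F - 1) * c * ∑ a, w a ^ 3 +
        (Fintype.card F - 1) * (Fintype.card F - 3) * ∑ a, w a ^ 4 := by
  rw [sum_eq_sum_axes]
  · have h0 : ∑ y : Fin n → F, axisFun c w (0 : Fin n → F) * axisFun c w y *
        axisFun c w (α • (0 : Fin n → F) + β • y) * axisFun c w (γ • (0 : Fin n → F) + δ • y) =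
        c * (c ^ 3 + (Fintype.card F - 1) * ∑ a, w a ^ 3) := by
      rw [← sum_comp_axisFun (F := F) c w (fun t => t ^ 3) (by simp), Finset.mul_sum]
      refine Finset.sum_congr rfl fun y _ => ?_
      simp only [smul_zero, zero_add, axisFun_smul c w hβ, axisFun_smul c w hδ, axisFun_zero]
      ring
    have h1 : ∀ (a : Fin n) (s : Fˣ), ∑ y : Fin n → F,
        axisFun c w (Pi.single a (s : F)) * axisFun c w y *
        axisFun c w (α • Pi.single a (s : F) + β • y) *
        axisFun c w (γ • Pi.single a (s : F) + δ • y) =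
        w a * (3 * c * w a ^ 2 + (Fintype.card F - 3) * w a ^ 3) := by
      intro a s
      rw [← sum_axis_prod c (w a) hα hβ hγ hδ hdet s.ne_zero, Finset.mul_sum]
      symm
      refine Fintype.sum_of_injective (fun t : F => (Pi.single a t : Fin n → F))
        (Pi.single_injective (M := fun _ => F) a) _ _ ?_ ?_
      · intro y hy
        by_cases hy0 : axisFun c w y = 0
        · simp [hy0]
        obtain ⟨b, t, ht, rfl⟩ := exists_of_axisFun_ne_zero hy0
          fun h => hy ⟨0, (Pi.single_zero a).trans h.symm⟩
        have hba : b ≠ a := by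
          rintro rfl
          exact hy ⟨t, rfl⟩
        have h0 : axisFun c w (α • (Pi.single a (s : F) : Fin n → F) +
            β • (Pi.single b t : Fin n → F)) = 0 := by
          refine axisFun_eq_zero_of_ne c w hba ?_ ?_
          · simp [Pi.single_eq_of_ne hba, hβ, ht]
          · simp [Pi.single_eq_of_ne hba.symm, hα]
        simp [h0]
      · intro t
        simp only [← Pi.single_smul, ← Pi.single_add, axisFun_single, smul_eq_mul, s.ne_zero,
          if_false]
        ring
    simp_rw [h1]
    rw [h0]
    simp only [Finset.sum_const, Finset.card_univ, nsmul_eq_mul, card_units_real, Finset.mul_sum,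
      mul_add]
    rw [add_assoc, add_assoc, ← Finset.sum_add_distrib, ← Finset.sum_add_distrib]
    congr 1
    · ring
    · exact Finset.sum_congr rfl fun a _ => by ring
  · intro x hx h
    have : axisFun c w x = 0 := by
      by_contra hne
      obtain ⟨a, s, hs, hxs⟩ := exists_of_axisFun_ne_zero hne hx
      exact h a s hs hxs
    simp [this]

end AxisFun

section Cases

variable {F : Type} [Field F] {m k : ℕ} {L : Matrix (Fin m) (Fin k) F}

theorem coordIndep_empty : CoordIndep L ∅ := fun _ => ⟨0, by simp, by simp⟩

theorem coordIndep_singleton_or (i : Fin k) :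
    CoordIndep L {i} ∨ ∀ x : Fin k → F, (∀ r, ∑ t, L r t * x t = 0) → x i = 0 := by
  by_cases h : CoordIndep L {i}
  · exact Or.inl h
  · obtain ⟨v, hv⟩ := coordIndep_empty.exists_eq_sum (Finset.notMem_empty i) h
    exact Or.inr fun x hx => by simpa using hv x hx

theorem coordIndep_pair_or {i j : Fin k} (hij : i ≠ j) :
    CoordIndep L {i, j} ∨
      (∀ x : Fin k → F, (∀ r, ∑ t, L r t * x t = 0) → x i = 0) ∨
      (∀ x : Fin k → F, (∀ r, ∑ t, L r t * x t = 0) → x j = 0) ∨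
      (CoordIndep L {i} ∧ ∃ s : F, s ≠ 0 ∧
        ∀ x : Fin k → F, (∀ r, ∑ t, L r t * x t = 0) → x j = s * x i) := by
  by_cases h : CoordIndep L {i, j}
  · exact Or.inl h
  rcases coordIndep_singleton_or (L := L) i with hi | hi
  · rw [Finset.pair_comm] at h
    obtain ⟨v, hv⟩ := hi.exists_eq_sum (by simpa using hij.symm) h
    simp only [Finset.sum_singleton] at hv
    by_cases hs : v i = 0
    · exact Or.inr (Or.inr (Or.inl fun x hx => by rw [hv x hx, hs, zero_mul]))
    · exact Or.inr (Or.inr (Or.inr ⟨hi, v i, hs, hv⟩))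
  · exact Or.inr (Or.inl hi)

/-- A sum with one sufficiently negative term is negative. -/
theorem sum_neg_of_le_of_le {ι : Type*} [DecidableEq ι] {s : Finset ι} {f : ι → ℝ} {d e C : ℝ}
    (he : 0 ≤ e) (hC : s.card ≤ C) (hf : ∀ i ∈ s, f i ≤ e) {i₀ : ι} (hi₀ : i₀ ∈ s)
    (hd : f i₀ ≤ -d) (hlt : C * e < d) : ∑ i ∈ s, f i < 0 := by
  rw [← Finset.add_sum_erase s f hi₀]
  have h1 : ∑ i ∈ s.erase i₀, f i ≤ (s.erase i₀).card • e :=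
    Finset.sum_le_card_nsmul _ _ _ fun i hi => hf i (Finset.mem_of_mem_erase hi)
  have h2 : ((s.erase i₀).card : ℝ) ≤ C :=
    le_trans (by exact_mod_cast Finset.card_le_card (Finset.erase_subset _ _)) hC
  rw [nsmul_eq_mul] at h1
  nlinarith [mul_le_mul_of_nonneg_right h2 he]

theorem card_powersetCard_univ_le (k r : ℕ) :
    ((powersetCard r (univ : Finset (Fin k))).card : ℝ) ≤ 2 ^ k := by
  rw [Finset.card_powersetCard, Finset.card_univ, Fintype.card_fin]
  exact_mod_cast Nat.choose_le_two_pow k r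

theorem not_coordIndep_erase_of_inducesOn {L' : Matrix (Fin 2) (Fin 4) F} {B : Finset (Fin k)}
    (hB : B.card = 4) (hL' : RowsIndep L') (hind : InducesOn L L' B hB) {e : Fin k}
    (he : e ∈ B) : ¬ CoordIndep L (B.erase e) := by
  intro hcoord
  set σ := B.orderIsoOfFin hB
  obtain ⟨t₀, ht₀⟩ := σ.surjective ⟨e, he⟩
  obtain ⟨s, hs0, hs⟩ : ∃ s : Fin 2 → F, s ≠ 0 ∧ ∑ i, s i * L' i t₀ = 0 := by
    by_cases h : L' 0 t₀ = 0
    · exact ⟨![1, 0], fun h0 => one_ne_zero (congrFun h0 0), by simp [Fin.sum_univ_two, h]⟩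
    · refine ⟨![-L' 1 t₀, L' 0 t₀], fun h0 => h (congrFun h0 1), ?_⟩
      simp [Fin.sum_univ_two]
      ring
  have hne : ∃ t₁, ∑ i, s i * L' i t₁ ≠ 0 := by
    by_contra! hall
    refine hs0 (funext fun i => Fintype.linearIndependent_iff.1 hL' s ?_ i)
    ext t
    simpa using hall t
  obtain ⟨t₁, ht₁⟩ := hne
  obtain ⟨x, hx, hxy⟩ := hcoord (Pi.single (σ t₁).1 1)
  apply ht₁
  have hsum : ∑ t, (∑ i, s i * L' i t) * x (σ t).1 = 0 := by
    simp_rw [Finset.sum_mul]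
    rw [Finset.sum_comm]
    refine Finset.sum_eq_zero fun i _ => ?_
    simp_rw [mul_assoc, ← Finset.mul_sum]
    rw [hind x hx i, mul_zero]
  rw [← hsum, Finset.sum_eq_single t₁]
  · rw [hxy, Pi.single_eq_same, mul_one]
    refine Finset.mem_erase.2 ⟨fun h => ht₁ ?_, (σ t₁).2⟩
    have : t₁ = t₀ := σ.injective (Subtype.ext (by rw [h, ht₀]))
    rw [this, hs]
  · intro t _ htt
    by_cases ht : t = t₀
    · rw [ht, hs, zero_mul]
    · rw [hxy, Pi.single_eq_of_ne, mul_zero]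
      · exact fun h => htt (σ.injective (Subtype.ext h))
      · refine Finset.mem_erase.2 ⟨fun h => ht ?_, (σ t).2⟩
        exact σ.injective (Subtype.ext (by rw [h, ht₀]))
  · simp

variable [Fintype F]

theorem two_le_card_real : (2 : ℝ) ≤ Fintype.card F := by
  exact_mod_cast Fintype.one_lt_card (α := F)

variable [DecidableEq F]

theorem Phi_eq_zero_of_coord_eq_zero {n : ℕ} {g : (Fin n → F) → ℝ} (hg : g 0 = 0)
    {B : Finset (Fin k)} {i : Fin k} (hiB : i ∈ B)
    (hi : ∀ x : Fin k → F, (∀ r, ∑ t, L r t * x t = 0) → x i = 0) : Phi L B g = 0 := by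
  rw [Phi, Finset.sum_eq_zero, zero_div]
  intro x hx
  refine Finset.prod_eq_zero hiB ?_
  rw [← hg]
  congr 1
  ext l
  exact hi (fun j => x j l) (solutions_coord hx l)

/-- Two proportional variables make an irredundant system uncommon. -/
theorem not_isCommon_of_proportional (hirr : IsIrredundant L) {i j : Fin k} (hij : i ≠ j)
    (hi : CoordIndep L {i}) {s : F} (hs : s ≠ 0)
    (hprop : ∀ x : Fin k → F, (∀ r, ∑ t, L r t * x t = 0) → x j = s * x i) :
    ¬ IsCommon L := by
  have hq := two_le_card_real (F := F)
  set q : ℝ := (Fintype.card F : ℝ) with hqdef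
  set g : (Fin 1 → F) → ℝ := fun x => -1 + (if x = 0 then 1 else 0) +
    (q - 1) * (if x = 1 then 1 else 0) with hg
  have hg0 : g 0 = 0 := by simp [hg]
  have hcard : ∑ _x : Fin 1 → F, (1 : ℝ) = q := by simp [hqdef]
  have hgsum : ∑ x, g x = 0 := by
    simp only [hg, Finset.sum_add_distrib, ← Finset.mul_sum, Finset.sum_neg_distrib, hcard,
      Finset.sum_ite_eq', Finset.mem_univ, if_true]
    ring
  have hcorr : ∀ s : F, s ≠ 0 → s ≠ 1 → ∑ x, g x * g (s • x) = -(q - 1) := by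
    intro s hs hs1
    have h1 : ∀ x : Fin 1 → F, s • x = 1 ↔ x = s⁻¹ • 1 := fun x => by
      rw [eq_inv_smul_iff₀ hs]
    have hne : (1 : Fin 1 → F) ≠ s⁻¹ • 1 := by
      intro h
      have := congrFun h 0
      exact hs1 (by simpa [eq_comm] using this)
    have hne0 : (0 : Fin 1 → F) ≠ s⁻¹ • 1 := by
      intro h
      have := congrFun h 0
      exact hs (by simpa [eq_comm] using this)
    have key : ∀ x : Fin 1 → F, g x * g (s • x) = 1 - (if x = 0 then 1 else 0) -
        (q - 1) * (if x = 1 then 1 else 0) - (q - 1) * (if x = s⁻¹ • 1 then 1 else 0) := by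
      intro x
      simp only [hg, smul_eq_zero, hs, false_or, h1]
      rcases eq_or_ne x 0 with rfl | hx0
      · simp [hne0]
      rcases eq_or_ne x 1 with rfl | hx1
      · simp [hne]
        ring
      simp only [hx0, hx1, if_false]
      split_ifs <;> ring
    simp_rw [key]
    simp only [Finset.sum_sub_distrib, ← Finset.mul_sum, hcard,
      Finset.sum_ite_eq', Finset.mem_univ, if_true]
    ring
  have hPhi : ∀ a b : Fin k, a ≠ b → CoordIndep L {a} → ∀ s : F, s ≠ 0 →
      (∀ x : Fin k → F, (∀ r, ∑ t, L r t * x t = 0) → x b = s * x a) →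
      Phi L {a, b} g < 0 := by
    intro a b hab ha s hs hsx
    have hs1 : s ≠ 1 := by
      rintro rfl
      exact hirr ⟨a, b, hab, fun x hx => by rw [hsx x hx, one_mul]⟩
    have : Phi L {a, b} g = -(q - 1) / q ^ 1 := by
      rw [← hcorr s hs hs1, hqdef, ← ha.avg_single, Phi]
      congr 1
      refine Finset.sum_congr rfl fun x hx => ?_
      rw [Finset.prod_pair hab]
      congr 2
      ext l
      exact hsx (fun j => x j l) (solutions_coord hx l)
    rw [this]
    exact div_neg_of_neg_of_pos (by linarith) (by positivity)
  refine not_isCommon_of_sum_Phi_neg L le_rfl g even_two two_ne_zero ?_ ?_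
  · intro r hr h0 h2
    interval_cases r
    simp at hr
  · refine Finset.sum_neg' ?_ ⟨{i, j}, by simp [Finset.card_pair hij], hPhi i j hij hi s hs hprop⟩
    intro B hB
    obtain ⟨a, b, hab, rfl⟩ := Finset.card_eq_two.1 (Finset.mem_powersetCard.1 hB).2
    rcases coordIndep_pair_or (L := L) hab with h | h | h | ⟨h, s, hs, hsx⟩
    · rw [h.Phi_eq_pow, hgsum, zero_div, Finset.card_pair hab, sq, zero_mul]
    · rw [Phi_eq_zero_of_coord_eq_zero hg0 (by simp) h]
    · rw [Phi_eq_zero_of_coord_eq_zero hg0 (by simp) h]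
    · exact (hPhi a b hab h s hs hsx).le

/-- A variable forced to be zero makes an irredundant system uncommon. -/
theorem not_isCommon_of_coord_eq_zero (hirr : IsIrredundant L) {z j : Fin k} (hzj : z ≠ j)
    (hz : ∀ x : Fin k → F, (∀ r, ∑ t, L r t * x t = 0) → x z = 0) : ¬ IsCommon L := by
  by_cases hprop : ∃ a b, a ≠ b ∧ CoordIndep L {a} ∧ ∃ s : F, s ≠ 0 ∧
      ∀ x : Fin k → F, (∀ r, ∑ t, L r t * x t = 0) → x b = s * x a
  · obtain ⟨a, b, hab, ha, s, hs, hsx⟩ := hprop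
    exact not_isCommon_of_proportional hirr hab ha hs hsx
  have hsing : ∀ a, a ≠ z → CoordIndep L {a} := by
    intro a haz
    refine (coordIndep_singleton_or a).resolve_right fun h => hirr ⟨a, z, haz, fun x hx => ?_⟩
    rw [h x hx, hz x hx]
  have hq := two_le_card_real (F := F)
  set q : ℝ := (Fintype.card F : ℝ) with hqdef
  set η : ℝ := 1 / (2 * 2 ^ k) with hη
  have hη0 : 0 < η := by positivity
  set v : ℝ := -(1 + η * q) / (q - 1) with hv
  have hv' : v * (q - 1) = -(1 + η * q) := div_mul_cancel₀ _ (by linarith)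
  set g : (Fin 1 → F) → ℝ := fun x => v + (1 - v) * (if x = 0 then 1 else 0) with hg
  have hg0 : g 0 = 1 := by simp [hg]
  have hcard : ∑ _x : Fin 1 → F, v = q * v := by simp [hqdef]
  have hgsum : (∑ x, g x) / q ^ 1 = -η := by
    simp only [hg, Finset.sum_add_distrib, ← Finset.mul_sum, hcard,
      Finset.sum_ite_eq', Finset.mem_univ, if_true, pow_one]
    rw [div_eq_iff (by positivity)]
    linear_combination hv'
  have hPhiz : ∀ b, b ≠ z → Phi L {z, b} g = -η := by
    intro b hbz
    rw [← hgsum, hqdef, ← (hsing b hbz).avg_single, Phi]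
    congr 1
    refine Finset.sum_congr rfl fun x hx => ?_
    have : x z = 0 := by
      ext l
      exact hz (fun j => x j l) (solutions_coord hx l)
    rw [Finset.prod_pair hbz.symm, this, hg0, one_mul]
  refine not_isCommon_of_sum_Phi_neg L le_rfl g even_two two_ne_zero ?_ ?_
  · intro r hr h0 h2
    interval_cases r
    simp at hr
  · refine sum_neg_of_le_of_le (d := η) (e := η ^ 2) (C := 2 ^ k) (i₀ := {z, j}) (by positivity)
      (card_powersetCard_univ_le k 2) ?_ (by simp [Finset.card_pair hzj])
      (hPhiz j hzj.symm).le ?_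
    · intro B hB
      obtain ⟨a, b, hab, rfl⟩ := Finset.card_eq_two.1 (Finset.mem_powersetCard.1 hB).2
      rcases eq_or_ne a z with rfl | haz
      · rw [hPhiz b hab.symm]; nlinarith
      rcases eq_or_ne b z with rfl | hbz
      · rw [Finset.pair_comm, hPhiz a hab]; nlinarith
      have hind : CoordIndep L {a, b} := by
        rcases coordIndep_pair_or (L := L) hab with h | h | h | ⟨h, s, hs, hsx⟩
        · exact h
        · exact absurd ⟨a, z, haz, fun x hx => by rw [h x hx, hz x hx]⟩ hirr
        · exact absurd ⟨b, z, hbz, fun x hx => by rw [h x hx, hz x hx]⟩ hirr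
        · exact absurd ⟨a, b, hab, h, s, hs, hsx⟩ hprop
      have := hind.Phi_eq_pow g
      rw [← hqdef, hgsum, Finset.card_pair hab, neg_sq] at this
      exact this.le
    · have : 2 ^ k * η = 1 / 2 := by rw [hη]; field_simp
      nlinarith

theorem abs_Phi_le {n : ℕ} (g : (Fin n → F) → ℝ) {B : Finset (Fin k)} {e : Fin k} (he : e ∈ B)
    (hB : B.card = 4) (hind : CoordIndep L (B.erase e)) :
    |Phi L B g| ≤ (∑ y, |g y|) ^ 4 / ((Fintype.card F : ℝ) ^ n) ^ 3 := by
  have h1 : |Phi L B g| ≤ (∑ y, |g y|) * Phi L (B.erase e) (fun y => |g y|) := by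
    rw [Phi, Phi, abs_div, Nat.abs_cast, ← mul_div_assoc, Finset.mul_sum]
    gcongr
    refine (Finset.abs_sum_le_sum_abs _ _).trans (Finset.sum_le_sum fun x _ => ?_)
    rw [← Finset.mul_prod_erase B _ he, abs_mul, Finset.abs_prod]
    gcongr
    exact Finset.single_le_sum (f := fun y => |g y|) (fun y _ => abs_nonneg _)
      (Finset.mem_univ (x e))
  rw [hind.Phi_eq_pow, Finset.card_erase_of_mem he, hB] at h1
  refine h1.trans (le_of_eq ?_)
  rw [div_pow]
  ring

theorem Phi_axisFun (hpair : ∀ i j : Fin k, i ≠ j → CoordIndep L {i, j}) {B : Finset (Fin k)}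
    (hB : B.card = 4) (hdep : ∀ e ∈ B, ¬ CoordIndep L (B.erase e)) {n : ℕ} (c₀ : ℝ)
    (w : Fin n → ℝ) :
    Phi L B (axisFun c₀ w) = (c₀ ^ 4 + 4 * (Fintype.card F - 1) * c₀ * ∑ a, w a ^ 3 +
        (Fintype.card F - 1) * (Fintype.card F - 3) * ∑ a, w a ^ 4) /
          ((Fintype.card F : ℝ) ^ n) ^ 2 := by
  obtain ⟨d, t, hdt, rfl, ht⟩ := Finset.card_eq_succ.1 hB
  obtain ⟨a, b, c, hab, hac, hbc, rfl⟩ := Finset.card_eq_three.1 ht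
  simp only [Finset.mem_insert, Finset.mem_singleton, not_or] at hdt
  obtain ⟨hda, hdb, hdc⟩ := hdt
  have h3 : ¬ CoordIndep L (insert c {a, b}) := by
    convert hdep d (by simp) using 2
    ext x
    simp only [Finset.mem_insert, Finset.mem_singleton, Finset.mem_erase]
    constructor
    · rintro (rfl | rfl | rfl) <;> simp [*, Ne.symm]
    · tauto
  have h4 : ¬ CoordIndep L (insert d {a, b}) := by
    convert hdep c (by simp) using 2
    ext x
    simp only [Finset.mem_insert, Finset.mem_singleton, Finset.mem_erase]
    constructor
    · rintro (rfl | rfl | rfl) <;> simp [*]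
    · tauto
  obtain ⟨u, hu⟩ := (hpair a b hab).exists_eq_sum (by simp [hac.symm, hbc.symm]) h3
  obtain ⟨v, hv⟩ := (hpair a b hab).exists_eq_sum (by simp [hda, hdb]) h4
  simp only [Finset.sum_pair hab] at hu hv
  have hsep : ∀ i j : Fin k, i ≠ j → ∃ x : Fin k → F, (∀ r, ∑ t, L r t * x t = 0) ∧
      x i = 0 ∧ x j = 1 := by
    intro i j hij
    obtain ⟨x, hx, hxy⟩ := hpair i j hij (Pi.single j 1)
    exact ⟨x, hx, by simpa [hij] using hxy i (by simp), by simpa using hxy j (by simp)⟩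
  have hua : u a ≠ 0 := by
    obtain ⟨x, hx, h0, h1⟩ := hsep b c hbc
    intro h
    simpa [h, h0, h1] using hu x hx
  have hub : u b ≠ 0 := by
    obtain ⟨x, hx, h0, h1⟩ := hsep a c hac
    intro h
    simpa [h, h0, h1] using hu x hx
  have hva : v a ≠ 0 := by
    obtain ⟨x, hx, h0, h1⟩ := hsep b d (Ne.symm hdb)
    intro h
    simpa [h, h0, h1] using hv x hx
  have hvb : v b ≠ 0 := by
    obtain ⟨x, hx, h0, h1⟩ := hsep a d (Ne.symm hda)
    intro h
    simpa [h, h0, h1] using hv x hx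
  have hdet : u a * v b - u b * v a ≠ 0 := by
    obtain ⟨x, hx, h0, h1⟩ := hsep c d (Ne.symm hdc)
    intro h
    have e1 := hu x hx
    have e2 := hv x hx
    rw [h0] at e1
    rw [h1] at e2
    have : u b = 0 := by linear_combination u b * e2 - v b * e1 - x a * h
    exact hub this
  rw [← sum_axisFun_quadruple c₀ w hua hub hva hvb hdet, ← (hpair a b hab).avg_pair hab, Phi]
  congr 1
  refine Finset.sum_congr rfl fun x hx => ?_
  have hxc : x c = u a • x a + u b • x b := by
    ext l
    exact hu (fun j => x j l) (solutions_coord hx l)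
  have hxd : x d = v a • x a + v b • x b := by
    ext l
    exact hv (fun j => x j l) (solutions_coord hx l)
  rw [Finset.prod_insert (by simp [hda, hdb, hdc]), Finset.prod_insert (by simp [hab, hac]),
    Finset.prod_pair hbc, ← hxc, ← hxd]
  ring

/-- If all pairs of variables are free and some four variables span only two dimensions, the
system is uncommon. -/
theorem not_isCommon_of_forall_pair (hpair : ∀ i j : Fin k, i ≠ j → CoordIndep L {i, j})
    {B₀ : Finset (Fin k)} (hB₀ : B₀.card = 4) (hdep : ∀ e ∈ B₀, ¬ CoordIndep L (B₀.erase e)) :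
    ¬ IsCommon L := by
  have hq := two_le_card_real (F := F)
  set q : ℝ := (Fintype.card F : ℝ) with hqdef
  obtain ⟨N, hN⟩ : ∃ N : ℕ, (N : ℝ) = q ^ 2 := ⟨Fintype.card F ^ 2, by simp [hqdef]⟩
  set M : ℝ := (q - 1) + (q - 1) * (N + 1 + N) with hM
  obtain ⟨r, hr⟩ := pow_unbounded_of_one_lt (2 ^ k * M ^ 4) (one_lt_two (α := ℝ))
  obtain ⟨n, w, hn, hrn, hsum⟩ : ∃ (n : ℕ) (w : Fin n → ℝ), 1 ≤ n ∧ r ≤ n ∧ ∀ φ : ℝ → ℝ,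
      ∑ a, φ (w a) = (N + 1) * φ 1 + 2 * N * φ (-1 / 2) + r * φ 0 :=
    ⟨(N + 1 + 2 * N) + r,
      Fin.append (Fin.append (fun _ => 1) (fun _ => -1 / 2)) (fun _ => 0),
      by omega, by omega, fun φ => by simp [Fin.sum_univ_add]⟩
  set g : (Fin n → F) → ℝ := axisFun (-(q - 1)) w with hg
  set P := (-(q - 1)) ^ 4 + 4 * (q - 1) * (-(q - 1)) * ∑ a, w a ^ 3 +
        (q - 1) * (q - 3) * ∑ a, w a ^ 4 with hP
  have hP1 : P ≤ -1 := by
    have h1 : P = (q - 1) ^ 2 * ((q - 1) ^ 2 - 15 / 8 * q ^ 2 - 3) -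
        2 * (q - 1) * (9 / 8 * q ^ 2 + 1) := by
      rw [hP, hsum fun t => t ^ 3, hsum fun t => t ^ 4, hN]
      ring
    rw [h1]
    have h2 : (q - 1) ^ 2 - 15 / 8 * q ^ 2 - 3 ≤ 0 := by nlinarith
    have h3 : (q - 1) ^ 2 * ((q - 1) ^ 2 - 15 / 8 * q ^ 2 - 3) ≤ 0 :=
      mul_nonpos_of_nonneg_of_nonpos (sq_nonneg _) h2
    nlinarith
  have hgsum : ∑ x, g x = 0 := by
    have := sum_comp_axisFun (F := F) (-(q - 1)) w id rfl
    rw [hsum id] at this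
    simp only [id] at this
    rw [hg, this]
    ring
  have hgabs : ∑ x, |g x| = M := by
    have := sum_comp_axisFun (F := F) (-(q - 1)) w (fun t => |t|) abs_zero
    rw [hsum fun t => |t|] at this
    rw [hg, this, abs_neg, abs_of_nonneg (by linarith : 0 ≤ q - 1), hM]
    norm_num
    ring
  have hX : 2 ^ k * M ^ 4 < q ^ n := by
    refine hr.trans_le ?_
    calc (2 : ℝ) ^ r ≤ q ^ r := by gcongr
      _ ≤ q ^ n := pow_le_pow_right₀ (by linarith) hrn
  set X := q ^ n with hXdef
  have hX0 : 0 < X := by positivity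
  refine not_isCommon_of_sum_Phi_neg L hn g (r := 4) (by decide) (by norm_num) ?_ ?_
  · intro j hj h0 h4
    have hj2 : j = 2 := by
      rcases hj with ⟨i, rfl⟩
      omega
    subst hj2
    refine Finset.sum_eq_zero fun B hB => ?_
    obtain ⟨a, b, hab, rfl⟩ := Finset.card_eq_two.1 (Finset.mem_powersetCard.1 hB).2
    rw [(hpair a b hab).Phi_eq_pow, hgsum, zero_div, Finset.card_pair hab, sq, zero_mul]
  · have hmain : ∀ B : Finset (Fin k), B.card = 4 → (∀ e ∈ B, ¬ CoordIndep L (B.erase e)) →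
        Phi L B g ≤ -(1 / X ^ 2) := by
      intro B hB hBdep
      rw [hg, Phi_axisFun hpair hB hBdep, ← hqdef, ← hP, ← neg_div]
      gcongr
    refine sum_neg_of_le_of_le (d := 1 / X ^ 2) (e := M ^ 4 / X ^ 3) (C := 2 ^ k) (i₀ := B₀)
      (by positivity) (card_powersetCard_univ_le k 4) ?_ (by simp [hB₀]) (hmain B₀ hB₀ hdep) ?_
    · intro B hB
      have hB4 := (Finset.mem_powersetCard.1 hB).2
      by_cases h : ∀ e ∈ B, ¬ CoordIndep L (B.erase e)
      · refine (hmain B hB4 h).trans ?_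
        have : 0 ≤ 1 / X ^ 2 := by positivity
        have : 0 ≤ M ^ 4 / X ^ 3 := by positivity
        linarith
      · push Not at h
        obtain ⟨e, he, hind⟩ := h
        rw [← hgabs]
        exact (le_abs_self _).trans (abs_Phi_le g he hB4 hind)
    · rw [← mul_div_assoc, div_lt_div_iff₀ (by positivity) (by positivity)]
      have := mul_lt_mul_of_pos_right hX (pow_pos hX0 2)
      linarith [this, pow_succ X 2]

end Cases

/-- any irredundant `(m × k)`-system over an odd prime power field that
induces a `(2 × 4)`-system as a subsystem is uncommon. -/
theorem uncommon_of_induces_two_by_four_system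
    {F : Type} [Field F] [Fintype F] [DecidableEq F] (hq : Odd (Fintype.card F))
    {m k : ℕ} (hm : 2 ≤ m) (hmk : m < k)
    (L : Matrix (Fin m) (Fin k) F) (hL : RowsIndep L) (hirr : IsIrredundant L)
    (hsub : ∃ (L' : Matrix (Fin 2) (Fin 4) F) (B : Finset (Fin k)) (hB : B.card = 4),
      RowsIndep L' ∧ InducesOn L L' B hB) :
    ¬ IsCommon L := by
  obtain ⟨L', B, hB, hL', hind⟩ := hsub
  by_cases hpair : ∀ i j : Fin k, i ≠ j → CoordIndep L {i, j}
  · exact not_isCommon_of_forall_pair hpair hB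
      fun e he => not_coordIndep_erase_of_inducesOn hB hL' hind he
  push Not at hpair
  obtain ⟨i, j, hij, h⟩ := hpair
  rcases (coordIndep_pair_or hij).resolve_left h with h | h | ⟨hi, s, hs, hsx⟩
  · exact not_isCommon_of_coord_eq_zero hirr hij h
  · exact not_isCommon_of_coord_eq_zero hirr hij.symm h
  · exact not_isCommon_of_proportional hirr hij hi hs hsx
end

section
/- Let q be an odd prime power and let 2 ≤ m < k be integers. Let L be an irredundant (m×k)-system over F_q. If L induces an arithmetic progression of length four as a subsystem, then L is uncommon. -/
open Finset

/-- The 4-term arithmetic progression system `x₁ − 2x₂ + x₃ = 0`, `x₂ − 2x₃ + x₄ = 0`. -/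
def ap4 (F : Type) [Field F] : Matrix (Fin 2) (Fin 4) F :=
  !![1, -2, 1, 0; 0, 1, -2, 1]

/-- Quadruples of functions `P` on `F^n` such that `∑ i, P i (y i) = 0` for every 4-AP `y`. -/
def apVanishing (F : Type) [Field F] (n : ℕ) : Submodule F (Fin 4 → (Fin n → F) → F) where
  carrier := {P | ∀ y : Fin 4 → Fin n → F,
    (∀ r, ∑ t, ap4 F r t • y t = 0) → ∑ i, P i (y i) = 0}
  add_mem' hP hQ y hy := by simp [Finset.sum_add_distrib, hP y hy, hQ y hy]
  zero_mem' y _ := by simp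
  smul_mem' c P hP y hy := by simp [← Finset.mul_sum, hP y hy]

section Functionals

variable {F : Type} [Field F] {n : ℕ} {ι : Type} [Fintype ι]

/-- The sign `1` or `-1` in `F` attached to a Boolean. -/
def boolSign (F : Type) [Field F] (b : Bool) : F := if b then 1 else -1

/-- The functional `P ↦ ∑ i, ± P (t i) (y i)` on quadruples that vanish on 4-APs. -/
def signedEval (y : ι → Fin n → F) (t : ι → Fin 4 × Bool) : apVanishing F n →ₗ[F] F where
  toFun P := ∑ i, boolSign F (t i).2 * P.1 (t i).1 (y i)
  map_add' P Q := by simp [mul_add, Finset.sum_add_distrib]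
  map_smul' c P := by simp [Finset.mul_sum, mul_left_comm]

theorem signedEval_apply (y : ι → Fin n → F) (t : ι → Fin 4 × Bool) (P : apVanishing F n) :
    signedEval y t P = ∑ i, boolSign F (t i).2 * P.1 (t i).1 (y i) := rfl

theorem fourAP_coords {y : Fin 4 → Fin n → F} (hy : ∀ r, ∑ t, ap4 F r t • y t = 0) (a : Fin n) :
    y 2 a = 2 * y 1 a - y 0 a ∧ y 3 a = 3 * y 1 a - 2 * y 0 a := by
  have h0 := congrFun (hy 0) a
  have h1 := congrFun (hy 1) a
  simp [ap4, Fin.sum_univ_four] at h0 h1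
  exact ⟨by linear_combination h0, by linear_combination h1 + 2 * h0⟩

theorem const_mem_apVanishing {θ : Fin 4 → F} (hθ : ∑ j, θ j = 0) :
    (fun j _ => θ j) ∈ apVanishing F n := fun _ _ => hθ

theorem coord_mem_apVanishing {b : Fin 4 → F} (h0 : b 0 = b 2 + 2 * b 3)
    (h1 : b 1 = -2 * b 2 - 3 * b 3) (a : Fin n) :
    (fun j x => b j * x a) ∈ apVanishing F n := by
  intro y hy
  obtain ⟨h2, h3⟩ := fourAP_coords hy a
  simp only [Fin.sum_univ_four, h2, h3, h0, h1]
  ring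

theorem coord_mul_coord_mem_apVanishing (a a' : Fin n) :
    (fun j x => (![1, -3, 3, -1] : Fin 4 → F) j * (x a * x a')) ∈ apVanishing F n := by
  intro y hy
  obtain ⟨h2, h3⟩ := fourAP_coords hy a
  obtain ⟨h2', h3'⟩ := fourAP_coords hy a'
  simp [Fin.sum_univ_four, h2, h3, h2', h3']
  ring

/-- If all linear and quadratic monomials take the same sums over `{x₁, x₃}` and `{x₂, x₄}`,
then `x₁ = x₂` or `x₂ = x₃`. -/
theorem eq_or_eq_of_quadratic_eq (h2 : (2 : F) ≠ 0) {x₁ x₂ x₃ x₄ : Fin n → F}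
    (hl : ∀ a, x₁ a + x₃ a = x₂ a + x₄ a)
    (hq : ∀ a b, x₁ a * x₁ b + x₃ a * x₃ b = x₂ a * x₂ b + x₄ a * x₄ b) :
    x₁ = x₂ ∨ x₂ = x₃ := by
  by_contra! h
  obtain ⟨a, ha⟩ := Function.ne_iff.1 h.1
  refine h.2 (funext fun b => ?_)
  have key : ∀ b c, (x₁ b - x₂ b) * (x₂ c - x₃ c) + (x₁ c - x₂ c) * (x₂ b - x₃ b) = 0 := by
    intro b c
    have e4 : ∀ a, x₄ a = x₁ a + x₃ a - x₂ a := fun a => by linear_combination -hl a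
    have := hq b c
    rw [e4, e4] at this
    linear_combination this
  have hw : x₂ a - x₃ a = 0 := by
    have := key a a
    have : (2 * (x₁ a - x₂ a)) * (x₂ a - x₃ a) = 0 := by linear_combination this
    exact (mul_eq_zero.1 this).resolve_left (mul_ne_zero h2 (sub_ne_zero.2 ha))
  have := key a b
  rw [hw, mul_zero, add_zero] at this
  exact sub_eq_zero.1 ((mul_eq_zero.1 this).resolve_left (sub_ne_zero.2 ha))

/-- For `p ≠ r` there is a linear quadruple vanishing at `r` but not at `p`. -/
theorem exists_linear_coeff (h2 : (2 : F) ≠ 0) (h3 : (3 : F) ≠ 0) {p r : Fin 4} (hpr : p ≠ r) :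
    ∃ b : Fin 4 → F, b 0 = b 2 + 2 * b 3 ∧ b 1 = -2 * b 2 - 3 * b 3 ∧ b p ≠ 0 ∧ b r = 0 := by
  have h1 : (1 : F) ≠ 0 := one_ne_zero
  fin_cases r
  · refine ⟨![0, 1, -2, 1], by simp, by simp; ring, ?_, by simp⟩
    fin_cases p <;> simp_all
  · refine ⟨![1, 0, -3, 2], by simp; ring, by simp; ring, ?_, by simp⟩
    fin_cases p <;> simp_all
  · refine ⟨![2, -3, 0, 1], by simp, by simp, ?_, by simp⟩
    fin_cases p <;> simp_all
  · refine ⟨![1, -2, 1, 0], by simp, by simp, ?_, by simp⟩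
    fin_cases p <;> simp_all

theorem not_paired {x₁ x₂ x₃ x₄ : Fin n → F} (h2 : (2 : F) ≠ 0) (h3 : (3 : F) ≠ 0)
    (h12 : x₁ ≠ x₂) (h23 : x₂ ≠ x₃) (h24 : x₂ ≠ x₄)
    (p r : Fin 4) {s u : F} (hs : s = 1 ∨ s = -1) (hu : u = 1 ∨ u = -1)
    (h : ∀ P ∈ apVanishing F n,
      s * P p x₁ - s * P p x₂ + u * P r x₃ - u * P r x₄ = 0) : False := by
  have hs0 : s ≠ 0 := by rcases hs with rfl | rfl <;> simp
  by_cases hpr : p = r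
  · subst hpr
    have hb : ∀ a, s * x₁ a - s * x₂ a + u * x₃ a - u * x₄ a = 0 := by
      intro a
      obtain ⟨r, hr⟩ : ∃ r, r ≠ p := exists_ne p
      obtain ⟨b, hb0, hb1, hbp, -⟩ := exists_linear_coeff h2 h3 hr.symm
      have := h _ (coord_mem_apVanishing hb0 hb1 a)
      refine (mul_eq_zero.1 ?_).resolve_left hbp
      linear_combination this
    have hc : ∀ a a', s * (x₁ a * x₁ a') - s * (x₂ a * x₂ a') + u * (x₃ a * x₃ a')
        - u * (x₄ a * x₄ a') = 0 := by
      intro a a'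
      have := h _ (coord_mul_coord_mem_apVanishing a a')
      refine (mul_eq_zero.1 ?_).resolve_left
        (show (![1, -3, 3, -1] : Fin 4 → F) p ≠ 0 by fin_cases p <;> simp [h3])
      linear_combination this
    rcases eq_or_ne u s with rfl | hus
    · rcases eq_or_eq_of_quadratic_eq h2
        (x₁ := x₁) (x₂ := x₂) (x₃ := x₃) (x₄ := x₄)
        (fun a => mul_left_cancel₀ hs0 (by linear_combination hb a))
        (fun a b => mul_left_cancel₀ hs0 (by linear_combination hc a b)) with h | h
      exacts [h12 h, h23 h]
    · have hus : u = -s := by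
        rcases hs with rfl | rfl <;> rcases hu with rfl | rfl <;> simp_all
      subst hus
      rcases eq_or_eq_of_quadratic_eq h2
        (x₁ := x₁) (x₂ := x₂) (x₃ := x₄) (x₄ := x₃)
        (fun a => mul_left_cancel₀ hs0 (by linear_combination hb a))
        (fun a b => mul_left_cancel₀ hs0 (by linear_combination hc a b)) with h | h
      exacts [h12 h, h24 h]
  · obtain ⟨b, hb0, hb1, hbp, hbr⟩ := exists_linear_coeff h2 h3 hpr
    refine h12 (funext fun a => ?_)
    have := h _ (coord_mem_apVanishing hb0 hb1 a)
    simp only [hbr] at this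
    refine mul_left_cancel₀ (mul_ne_zero hs0 hbp) ?_
    linear_combination this

theorem boolSign_eq (b : Bool) : boolSign F b = 1 ∨ boolSign F b = -1 := by
  cases b <;> simp [boolSign]

/-- If the functional vanishes and misses a slot, the signs over every slot cancel. -/
theorem sum_boolSign_eq_zero {y : ι → Fin n → F} {t : ι → Fin 4 × Bool}
    (ht : signedEval y t = 0) {j₀ : Fin 4} (hj : ∀ i, (t i).1 ≠ j₀) (j : Fin 4) :
    ∑ i, (if (t i).1 = j then boolSign F (t i).2 else 0) = 0 := by
  by_cases hjj : j = j₀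
  · exact Finset.sum_eq_zero fun i _ => if_neg fun h => hj i (h.trans hjj)
  have hθ : ∑ l, ((if l = j then 1 else 0) - (if l = j₀ then 1 else 0) : F) = 0 := by simp
  have := LinearMap.congr_fun ht ⟨_, const_mem_apVanishing (n := n) hθ⟩
  simpa [signedEval_apply, hj] using this

theorem signedEval_two_ne_zero (h2 : (2 : F) ≠ 0) (h3 : (3 : F) ≠ 0)
    {y : Fin 2 → Fin n → F} (hy : Function.Injective y) (t : Fin 2 → Fin 4 × Bool) :
    signedEval y t ≠ 0 := by
  intro ht
  obtain ⟨j₀, hj₀⟩ : ∃ j₀ : Fin 4, ∀ i, (t i).1 ≠ j₀ := by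
    have : ∀ a b : Fin 4, ∃ j₀, a ≠ j₀ ∧ b ≠ j₀ := by decide
    obtain ⟨j₀, h⟩ := this (t 0).1 (t 1).1
    exact ⟨j₀, Fin.forall_fin_two.2 h⟩
  have hs := sum_boolSign_eq_zero ht hj₀ (t 0).1
  have hne : boolSign F (t 0).2 ≠ 0 := by
    rcases boolSign_eq (F := F) (t 0).2 with h | h <;> simp [h]
  have h01 : (t 1).1 = (t 0).1 := by
    by_contra h
    simp [Fin.sum_univ_two, h, hne] at hs
  simp only [Fin.sum_univ_two, h01, if_true] at hs
  obtain ⟨r, hr⟩ : ∃ r, r ≠ (t 0).1 := exists_ne _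
  obtain ⟨b, hb0, hb1, hbp, -⟩ := exists_linear_coeff h2 h3 hr.symm
  refine absurd (hy (a₁ := 0) (a₂ := 1) (funext fun a => ?_)) (by decide)
  have := LinearMap.congr_fun ht ⟨_, coord_mem_apVanishing hb0 hb1 a⟩
  simp only [signedEval_apply, Fin.sum_univ_two, h01, LinearMap.zero_apply] at this
  refine mul_left_cancel₀ (mul_ne_zero hne hbp) ?_
  linear_combination this - b (t 0).1 * y 1 a * hs

theorem bijective_of_signedEval_eq_zero (h2 : (2 : F) ≠ 0) (h3 : (3 : F) ≠ 0)
    {y : Fin 4 → Fin n → F} (hy : Function.Injective y) {t : Fin 4 → Fin 4 × Bool}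
    (ht : signedEval y t = 0) : Function.Bijective fun i => (t i).1 := by
  rw [← Finite.surjective_iff_bijective]
  by_contra hsurj
  obtain ⟨j₀, hj₀⟩ : ∃ j₀, ∀ i, (t i).1 ≠ j₀ := by
    simpa [Function.Surjective] using hsurj
  have hs := sum_boolSign_eq_zero ht hj₀
  have hP : ∀ P ∈ apVanishing F n, ∑ i, boolSign F (t i).2 * P (t i).1 (y i) = 0 :=
    fun P hP => LinearMap.congr_fun ht ⟨P, hP⟩
  have hsgn := fun i => boolSign_eq (F := F) (t i).2
  generalize hσ : (fun i => boolSign F (t i).2) = σ at *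
  generalize hτ : (fun i => (t i).1) = τ at *
  simp only [funext_iff] at hσ hτ
  simp only [hσ, hτ] at hs hP hsgn
  have hyne : ∀ {i j}, i ≠ j → y i ≠ y j := fun h => hy.ne h
  have hpair : ∀ a b c d : Fin 4, a ≠ b → b ≠ c → b ≠ d →
      (∀ f : Fin 4 → F, ∑ i, f i = f a + f b + f c + f d) → τ b = τ a → σ b = -σ a → False := by
    intro a b c d hab hbc hbd hsum hτ hσ
    have hcd : τ d = τ c ∧ σ d = -σ c := by
      have h1 := hs (τ c)
      have hc : σ c ≠ 0 := by rcases hsgn c with h | h <;> simp [h]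
      rw [hsum, hτ, hσ] at h1
      by_cases hdc : τ d = τ c
      · refine ⟨hdc, ?_⟩
        by_cases hac : τ a = τ c <;> simp [hdc, hac] at h1 <;> linear_combination h1
      · by_cases hac : τ a = τ c <;> simp [hdc, hac, hc] at h1
    refine not_paired h2 h3 (hyne hab) (hyne hbc) (hyne hbd) (τ a) (τ c)
      (hsgn a) (hsgn c) fun P hPm => ?_
    have := hP P hPm
    rw [hsum, hτ, hσ, hcd.1, hcd.2] at this
    linear_combination this
  have h4 : (4 : F) ≠ 0 := by
    rw [show (4 : F) = 2 * 2 by norm_num]; exact mul_ne_zero h2 h2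
  obtain ⟨i, hi, hτi, hσi⟩ : ∃ i, i ≠ 0 ∧ τ i = τ 0 ∧ σ i = -σ 0 := by
    by_contra! h
    have heq : ∀ i, τ i = τ 0 → σ i = σ 0 := by
      intro i hi
      rcases eq_or_ne i 0 with rfl | h0
      · rfl
      have := h i h0 hi
      rcases hsgn i with h | h <;> rcases hsgn 0 with h' | h' <;> simp_all
    have hsum := hs (τ 0)
    have hc : σ 0 ≠ 0 := by rcases hsgn 0 with h | h <;> simp [h]
    have : ∀ i, (if τ i = τ 0 then σ i else 0) = (if τ i = τ 0 then 1 else 0) * σ 0 := by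
      intro i
      split_ifs with h
      · rw [heq i h, one_mul]
      · simp
    simp only [this, ← Finset.sum_mul, mul_eq_zero, hc, or_false, Fin.sum_univ_four, if_true]
      at hsum
    split_ifs at hsum <;> norm_num at hsum <;> contradiction
  fin_cases i
  · exact hi rfl
  · exact hpair 0 1 2 3 (by decide) (by decide) (by decide)
      (fun f => Fin.sum_univ_four f) hτi hσi
  · exact hpair 0 2 1 3 (by decide) (by decide) (by decide)
      (fun f => by rw [Fin.sum_univ_four]; ring) hτi hσi
  · exact hpair 0 3 1 2 (by decide) (by decide) (by decide)
      (fun f => by rw [Fin.sum_univ_four]; ring) hτi hσi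

end Functionals

section Moments

variable {F : Type} [Field F] {n : ℕ} {ι : Type} [Fintype ι]

/-- The weights `-1, 1, 1, 1` of the four slots. -/
def slotWeight (j : Fin 4) : ℝ := if j = 0 then -1 else 1

theorem sum_addChar_linear [Fintype (apVanishing F n)] {ψ : AddChar F ℂ} (hψ : ψ ≠ 0)
    (l : apVanishing F n →ₗ[F] F) [Decidable (l = 0)] :
    ∑ P, ψ (l P) = if l = 0 then (Fintype.card (apVanishing F n) : ℂ) else 0 := by
  classical
  have := AddChar.sum_eq_ite (ψ.compAddMonoidHom l.toAddMonoidHom)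
  simp only [AddChar.compAddMonoidHom_apply, LinearMap.toAddMonoidHom_coe] at this
  rw [this]
  refine if_congr ?_ rfl rfl
  constructor
  · intro h
    by_contra hl
    obtain ⟨P, hP⟩ := DFunLike.ne_iff.1 hl
    obtain ⟨a, ha⟩ := AddChar.ne_one_iff.1 hψ
    refine ha ?_
    have h' := DFunLike.congr_fun h ((a * (l P)⁻¹) • P)
    simp only [AddChar.compAddMonoidHom_apply, LinearMap.toAddMonoidHom_coe, map_smul,
      smul_eq_mul, AddChar.zero_apply] at h'
    rwa [mul_assoc, inv_mul_cancel₀ hP, mul_one] at h'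
  · rintro rfl
    ext P
    simp

variable [Fintype F]

/-- The real test function attached to a quadruple `P` and an additive character `ψ`. -/
noncomputable def testFun (ψ : AddChar F ℂ) (P : Fin 4 → (Fin n → F) → F) (x : Fin n → F) : ℝ :=
  (∑ j, slotWeight j * (ψ (P j x)).re) / 4

theorem abs_testFun_le (ψ : AddChar F ℂ) (P : Fin 4 → (Fin n → F) → F) (x : Fin n → F) :
    |testFun ψ P x| ≤ 1 := by
  have h : ∀ j ∈ (Finset.univ : Finset (Fin 4)), |slotWeight j * (ψ (P j x)).re| ≤ 1 := by
    intro j _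
    have hw : |slotWeight j| = 1 := by unfold slotWeight; split_ifs <;> simp
    rw [abs_mul, hw, one_mul]
    exact (Complex.abs_re_le_norm _).trans (AddChar.norm_apply ψ _).le
  have := (Finset.abs_sum_le_sum_abs _ _).trans (Finset.sum_le_sum h)
  rw [testFun, abs_div, abs_of_pos (four_pos : (0 : ℝ) < 4), div_le_one four_pos]
  simpa using this

theorem ofReal_testFun (ψ : AddChar F ℂ) (P : Fin 4 → (Fin n → F) → F) (x : Fin n → F) :
    ((8 * testFun ψ P x : ℝ) : ℂ) =
      ∑ t : Fin 4 × Bool, (slotWeight t.1 : ℂ) * ψ (boolSign F t.2 * P t.1 x) := by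
  have h : ∀ j, (slotWeight j : ℂ) * ψ (boolSign F true * P j x)
      + (slotWeight j : ℂ) * ψ (boolSign F false * P j x)
      = ((2 * (slotWeight j * (ψ (P j x)).re) : ℝ) : ℂ) := by
    intro j
    rw [← mul_add]
    simp only [boolSign, if_true, one_mul, Bool.false_eq_true, if_false, neg_one_mul,
      AddChar.map_neg_eq_conj, Complex.add_conj]
    push_cast
    ring
  rw [Fintype.sum_prod_type]
  simp only [Fintype.sum_bool, h]
  rw [← Complex.ofReal_sum, ← Finset.mul_sum, testFun]
  congr 1
  ring

open Classical in
theorem sum_prod_testFun [DecidableEq ι] [Fintype (apVanishing F n)] {ψ : AddChar F ℂ} (hψ : ψ ≠ 0)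
    (y : ι → Fin n → F) :
    8 ^ Fintype.card ι * ∑ P : apVanishing F n, ∏ i, testFun ψ P.1 (y i) =
      ∑ t : ι → Fin 4 × Bool, (∏ i, slotWeight (t i).1) *
        if signedEval y t = 0 then (Fintype.card (apVanishing F n) : ℝ) else 0 := by
  have hL : (((8 ^ Fintype.card ι * ∑ P : apVanishing F n, ∏ i, testFun ψ P.1 (y i) : ℝ)) : ℂ)
      = ∑ P : apVanishing F n, ∏ i, ((8 * testFun ψ P.1 (y i) : ℝ) : ℂ) := by
    push_cast
    simp [Finset.prod_mul_distrib, Finset.mul_sum]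
  have hterm : ∀ (P : apVanishing F n) (t : ι → Fin 4 × Bool),
      ∏ i, ψ (boolSign F (t i).2 * P.1 (t i).1 (y i)) = ψ (signedEval y t P) := by
    intro P t
    rw [signedEval_apply]
    exact (map_prod ψ.toMonoidHom _ _).symm
  refine Complex.ofReal_injective ?_
  rw [hL]
  simp only [ofReal_testFun, Fintype.prod_sum, Finset.prod_mul_distrib, hterm]
  rw [Finset.sum_comm]
  simp only [← Finset.mul_sum, sum_addChar_linear hψ]
  push_cast
  refine Finset.sum_congr rfl fun t _ => ?_
  split_ifs <;> simp

theorem sum_testFun_mul_testFun [Fintype (apVanishing F n)] (h2 : (2 : F) ≠ 0) (h3 : (3 : F) ≠ 0)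
    {ψ : AddChar F ℂ} (hψ : ψ ≠ 0) {y : Fin 2 → Fin n → F} (hy : Function.Injective y) :
    ∑ P : apVanishing F n, ∏ i, testFun ψ P.1 (y i) = 0 := by
  have := sum_prod_testFun hψ y
  simpa [signedEval_two_ne_zero h2 h3 hy] using this

theorem prod_slotWeight_eq {t : Fin 4 → Fin 4 × Bool}
    (ht : Function.Bijective fun i => (t i).1) : ∏ i, slotWeight (t i).1 = -1 := by
  rw [ht.prod_comp slotWeight]
  simp [slotWeight]

open Classical in
theorem sum_prod_testFun_four_nonpos [Fintype (apVanishing F n)] (h2 : (2 : F) ≠ 0)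
    (h3 : (3 : F) ≠ 0) {ψ : AddChar F ℂ} (hψ : ψ ≠ 0) {y : Fin 4 → Fin n → F}
    (hy : Function.Injective y) :
    ∑ P : apVanishing F n, ∏ i, testFun ψ P.1 (y i) ≤ 0 := by
  have h := sum_prod_testFun hψ y
  have : 8 ^ Fintype.card (Fin 4) * ∑ P : apVanishing F n, ∏ i, testFun ψ P.1 (y i) ≤ 0 := by
    rw [h]
    refine Finset.sum_nonpos fun t _ => ?_
    split_ifs with ht
    · rw [prod_slotWeight_eq (bijective_of_signedEval_eq_zero h2 h3 hy ht)]
      simp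
    · simp
  exact nonpos_of_mul_nonpos_right this (by positivity)

open Classical in
theorem sum_prod_testFun_fourAP [Fintype (apVanishing F n)] (h2 : (2 : F) ≠ 0)
    (h3 : (3 : F) ≠ 0) {ψ : AddChar F ℂ} (hψ : ψ ≠ 0) {y : Fin 4 → Fin n → F}
    (hy : Function.Injective y) (hap : ∀ r, ∑ t, ap4 F r t • y t = 0) :
    ∑ P : apVanishing F n, ∏ i, testFun ψ P.1 (y i)
      ≤ -(Fintype.card (apVanishing F n) / 8 ^ 4) := by
  have h := sum_prod_testFun hψ y
  have h0 : signedEval y (fun i => (i, true)) = 0 := by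
    ext P
    simpa [signedEval_apply, boolSign] using P.2 y hap
  rw [← Finset.add_sum_erase _ _ (Finset.mem_univ fun i => (i, true)), if_pos h0,
    prod_slotWeight_eq (bijective_of_signedEval_eq_zero h2 h3 hy h0)] at h
  have hrest : ∑ t ∈ (Finset.univ : Finset (Fin 4 → Fin 4 × Bool)).erase fun i => (i, true),
      (∏ i, slotWeight (t i).1) *
        (if signedEval y t = 0 then (Fintype.card (apVanishing F n) : ℝ) else 0) ≤ 0 := by
    refine Finset.sum_nonpos fun t _ => ?_
    split_ifs with ht
    · rw [prod_slotWeight_eq (bijective_of_signedEval_eq_zero h2 h3 hy ht)]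
      simp
    · simp
  rw [Fintype.card_fin] at h
  linarith

end Moments

section Expansion

/-- The elementary symmetric polynomial of degree `m` in the values of `y`. -/
def esymmFun {k : ℕ} (y : Fin k → ℝ) (m : ℕ) : ℝ :=
  ∑ B ∈ Finset.powersetCard m Finset.univ, ∏ i ∈ B, y i

theorem prod_half_add {k : ℕ} (y : Fin k → ℝ) (ε : ℝ) :
    ∏ i, (1 / 2 + ε * y i) =
      ∑ m ∈ Finset.range (k + 1), ε ^ m * (1 / 2) ^ (k - m) * esymmFun y m := by
  have h : ∏ i, (1 / 2 + ε * y i) = ∑ B ∈ (Finset.univ : Finset (Fin k)).powerset,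
      ε ^ B.card * (1 / 2) ^ (k - B.card) * ∏ i ∈ B, y i := by
    simp only [add_comm (1 / 2 : ℝ)]
    rw [Finset.prod_add]
    refine Finset.sum_congr rfl fun B _ => ?_
    rw [Finset.prod_mul_distrib, Finset.prod_const, Finset.prod_const,
      Finset.card_sdiff_of_subset (Finset.subset_univ _), Finset.card_univ, Fintype.card_fin]
    ring
  rw [h, Finset.sum_powerset, Finset.card_univ, Fintype.card_fin]
  refine Finset.sum_congr rfl fun m _ => ?_
  rw [esymmFun, Finset.mul_sum]
  refine Finset.sum_congr rfl fun B hB => ?_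
  rw [(Finset.mem_powersetCard.1 hB).2]

theorem abs_esymmFun_le {k : ℕ} {y : Fin k → ℝ} (hy : ∀ i, |y i| ≤ 1) (m : ℕ) :
    |esymmFun y m| ≤ k.choose m := by
  refine (Finset.abs_sum_le_sum_abs _ _).trans ?_
  have : ∀ B ∈ Finset.powersetCard m (Finset.univ : Finset (Fin k)), |∏ i ∈ B, y i| ≤ 1 := by
    intro B _
    rw [Finset.abs_prod]
    exact Finset.prod_le_one (fun i _ => abs_nonneg _) fun i _ => hy i
  refine (Finset.sum_le_sum this).trans ?_
  simp

theorem prod_half_add_add_prod_half_sub_le {k : ℕ} (hk : 4 ≤ k) {y : Fin k → ℝ}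
    (hy : ∀ i, |y i| ≤ 1) {ε : ℝ} (hε : 0 ≤ ε) (hε1 : ε ≤ 1) :
    ∏ i, (1 / 2 + ε * y i) + ∏ i, (1 / 2 - ε * y i) ≤
      2 * (1 / 2) ^ k + 2 * ε ^ 2 * (1 / 2) ^ (k - 2) * esymmFun y 2
        + 2 * ε ^ 4 * (1 / 2) ^ (k - 4) * esymmFun y 4 + 2 ^ (k + 1) * ε ^ 5 := by
  have hsub : ∏ i, (1 / 2 - ε * y i) = ∏ i, (1 / 2 + (-ε) * y i) := by
    simp only [neg_mul, sub_eq_add_neg]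
  rw [hsub, prod_half_add, prod_half_add, ← Finset.sum_add_distrib]
  have hsplit : k + 1 = 5 + (k - 4) := by omega
  rw [hsplit, Finset.sum_range_add]
  have htail : ∑ x ∈ Finset.range (k - 4),
      (ε ^ (5 + x) * (1 / 2) ^ (k - (5 + x)) * esymmFun y (5 + x)
        + (-ε) ^ (5 + x) * (1 / 2) ^ (k - (5 + x)) * esymmFun y (5 + x)) ≤
      2 ^ (k + 1) * ε ^ 5 := by
    have hterm : ∀ x ∈ Finset.range (k - 4),
        (ε ^ (5 + x) * (1 / 2) ^ (k - (5 + x)) * esymmFun y (5 + x)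
        + (-ε) ^ (5 + x) * (1 / 2) ^ (k - (5 + x)) * esymmFun y (5 + x)) ≤
        2 * ε ^ 5 * k.choose (5 + x) := by
      intro x _
      have hone : ∀ δ : ℝ, |δ| = ε → δ ^ (5 + x) * (1 / 2) ^ (k - (5 + x)) * esymmFun y (5 + x)
          ≤ ε ^ 5 * k.choose (5 + x) := by
        intro δ hδ
        refine (le_abs_self _).trans ?_
        rw [abs_mul, abs_mul, abs_pow, hδ, abs_pow]
        refine mul_le_mul ?_ (abs_esymmFun_le hy _) (abs_nonneg _) (by positivity)
        have h1 : ε ^ (5 + x) ≤ ε ^ 5 := pow_le_pow_of_le_one hε hε1 (by omega)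
        have h2 : |(1 / 2 : ℝ)| ^ (k - (5 + x)) ≤ 1 :=
          pow_le_one₀ (abs_nonneg _) (by rw [abs_of_pos] <;> norm_num)
        calc ε ^ (5 + x) * |(1 / 2 : ℝ)| ^ (k - (5 + x)) ≤ ε ^ 5 * 1 := by gcongr
          _ = ε ^ 5 := mul_one _
      have := hone ε (abs_of_nonneg hε)
      have := hone (-ε) (by rw [abs_neg, abs_of_nonneg hε])
      linarith
    refine (Finset.sum_le_sum hterm).trans ?_
    rw [← Finset.mul_sum]
    have hchoose : ∑ x ∈ Finset.range (k - 4), (k.choose (5 + x) : ℝ) ≤ 2 ^ k := by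
      have h := Nat.sum_range_choose k
      rw [hsplit, Finset.sum_range_add] at h
      have : ∑ x ∈ Finset.range (k - 4), k.choose (5 + x) ≤ 2 ^ k := by omega
      exact_mod_cast this
    calc 2 * ε ^ 5 * ∑ x ∈ Finset.range (k - 4), (k.choose (5 + x) : ℝ)
        ≤ 2 * ε ^ 5 * 2 ^ k := by gcongr
      _ = _ := by ring
  have h0 : esymmFun y 0 = 1 := by simp [esymmFun]
  have hhead : ∑ x ∈ Finset.range 5, (ε ^ x * (1 / 2) ^ (k - x) * esymmFun y x
        + (-ε) ^ x * (1 / 2) ^ (k - x) * esymmFun y x) =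
      2 * (1 / 2) ^ k + 2 * ε ^ 2 * (1 / 2) ^ (k - 2) * esymmFun y 2
        + 2 * ε ^ 4 * (1 / 2) ^ (k - 4) * esymmFun y 4 := by
    simp only [Finset.sum_range_succ, Finset.sum_range_zero, h0, Nat.sub_zero]
    ring
  rw [hhead, ← hsplit]
  linarith

theorem prod_half_add_add_prod_half_sub_le_two {k : ℕ} {y : Fin k → ℝ}
    (hy : ∀ i, |y i| ≤ 1) {ε : ℝ} (hε : 0 ≤ ε) (hε1 : ε ≤ 1 / 2) :
    ∏ i, (1 / 2 + ε * y i) + ∏ i, (1 / 2 - ε * y i) ≤ 2 := by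
  have hb : ∀ i, |ε * y i| ≤ 1 / 2 := fun i => by
    rw [abs_mul, abs_of_nonneg hε]
    calc ε * |y i| ≤ 1 / 2 * 1 := by gcongr; exact hy i
      _ = _ := by norm_num
  have hb' := fun i => abs_le.1 (hb i)
  have h1 : ∏ i, (1 / 2 + ε * y i) ≤ 1 :=
    Finset.prod_le_one (fun i _ => by linarith [(hb' i).1]) fun i _ => by linarith [(hb' i).2]
  have h2 : ∏ i, (1 / 2 - ε * y i) ≤ 1 :=
    Finset.prod_le_one (fun i _ => by linarith [(hb' i).2]) fun i _ => by linarith [(hb' i).1]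
  linarith

end Expansion

section Collisions

variable {F : Type} [Field F] [Fintype F] [DecidableEq F]

theorem card_solutions_eq_mul_le {m k : ℕ} {L : Matrix (Fin m) (Fin k) F}
    (hirr : IsIrredundant L) (n : ℕ) {i j : Fin k} (hij : i ≠ j) :
    ((solutions L n).filter fun x => x i = x j).card * Fintype.card F ^ n
      ≤ (solutions L n).card := by
  obtain ⟨v, hv, hne⟩ : ∃ v : Fin k → F, (∀ r, ∑ t, L r t * v t = 0) ∧ v i ≠ v j := by
    by_contra! h
    exact hirr ⟨i, j, hij, h⟩
  have hcard : Fintype.card F ^ n = (Finset.univ : Finset (Fin n → F)).card := by simp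
  rw [hcard, ← Finset.card_product]
  refine Finset.card_le_card_of_injOn (fun p => fun l => p.1 l + v l • p.2) ?_ ?_
  · rintro ⟨x, w⟩ hx
    simp only [Finset.coe_product, Set.mem_prod, Finset.mem_coe, Finset.mem_filter, solutions,
      Finset.mem_univ, true_and] at hx ⊢
    intro r
    have := hx.1.1 r
    simp only [smul_add, Finset.sum_add_distrib, this, smul_smul, ← Finset.sum_smul, hv r,
      zero_smul, add_zero]
  · rintro ⟨x, w⟩ hx ⟨x', w'⟩ hx' h
    simp only [Finset.coe_product, Set.mem_prod, Finset.mem_coe, Finset.mem_filter] at hx hx'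
    have hi := congrFun h i
    have hj := congrFun h j
    simp only [hx.1.2, hx'.1.2] at hi hj
    have hw : w = w' := by
      have : (v i - v j) • (w - w') = 0 := by
        rw [sub_smul, smul_sub, smul_sub]
        linear_combination (exp := 1) hi - hj
      exact sub_eq_zero.1 ((smul_eq_zero.1 this).resolve_left (sub_ne_zero.2 hne))
    subst hw
    refine Prod.ext (funext fun l => ?_) rfl
    exact add_right_cancel (congrFun h l)

theorem card_not_injective_mul_le {m k : ℕ} {L : Matrix (Fin m) (Fin k) F}
    (hirr : IsIrredundant L) (n : ℕ) [DecidablePred fun x : Fin k → Fin n → F =>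
      Function.Injective x] :
    ((solutions L n).filter fun x => ¬ Function.Injective x).card * Fintype.card F ^ n
      ≤ k ^ 2 * (solutions L n).card := by
  have hsub : ((solutions L n).filter fun x => ¬ Function.Injective x) ⊆
      (Finset.univ : Finset (Fin k)).offDiag.biUnion fun p =>
        (solutions L n).filter fun x => x p.1 = x p.2 := by
    intro x hx
    simp only [Finset.mem_filter, Function.Injective, not_forall] at hx
    obtain ⟨hx, i, j, h, hij⟩ := hx
    simp only [Finset.mem_biUnion, Finset.mem_offDiag, Finset.mem_filter]
    exact ⟨(i, j), ⟨Finset.mem_univ _, Finset.mem_univ _, hij⟩, hx, h⟩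
  calc _ ≤ (∑ p ∈ (Finset.univ : Finset (Fin k)).offDiag,
        ((solutions L n).filter fun x => x p.1 = x p.2).card) * Fintype.card F ^ n := by
        gcongr
        exact (Finset.card_le_card hsub).trans Finset.card_biUnion_le
    _ ≤ ∑ _p ∈ (Finset.univ : Finset (Fin k)).offDiag, (solutions L n).card := by
        rw [Finset.sum_mul]
        exact Finset.sum_le_sum fun p hp =>
          card_solutions_eq_mul_le hirr n (Finset.mem_offDiag.1 hp).2.2
    _ ≤ k ^ 2 * (solutions L n).card := by
        rw [Finset.sum_const, smul_eq_mul, Finset.offDiag_card]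
        gcongr
        simp [sq]

end Collisions

section Averaging

variable {k : ℕ}

theorem prod_finset_eq_prod_fin {m : ℕ} (B : Finset (Fin k)) (hB : B.card = m) (f : Fin k → ℝ) :
    ∏ i ∈ B, f i = ∏ t, f (B.orderIsoOfFin hB t).1 := by
  rw [← Finset.prod_coe_sort]
  exact (Equiv.prod_comp (B.orderIsoOfFin hB).toEquiv fun i : B => f i).symm

theorem injective_comp_orderIsoOfFin {m : ℕ} {α : Type} (B : Finset (Fin k)) (hB : B.card = m)
    {x : Fin k → α} (hx : Function.Injective x) :
    Function.Injective fun t => x (B.orderIsoOfFin hB t).1 :=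
  hx.comp (Subtype.val_injective.comp (B.orderIsoOfFin hB).injective)

variable {F : Type} [Field F] [Fintype F] {n : ℕ}

theorem sum_esymmFun_two [Fintype (apVanishing F n)] (h2 : (2 : F) ≠ 0) (h3 : (3 : F) ≠ 0)
    {ψ : AddChar F ℂ} (hψ : ψ ≠ 0) {x : Fin k → Fin n → F} (hx : Function.Injective x) :
    ∑ P : apVanishing F n, esymmFun (fun i => testFun ψ P.1 (x i)) 2 = 0 := by
  simp only [esymmFun]
  rw [Finset.sum_comm]
  refine Finset.sum_eq_zero fun B hB => ?_
  have hB := (Finset.mem_powersetCard.1 hB).2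
  simp only [prod_finset_eq_prod_fin B hB]
  exact sum_testFun_mul_testFun h2 h3 hψ (injective_comp_orderIsoOfFin B hB hx)

theorem sum_esymmFun_four_le [Fintype (apVanishing F n)] (h2 : (2 : F) ≠ 0) (h3 : (3 : F) ≠ 0)
    {ψ : AddChar F ℂ} (hψ : ψ ≠ 0) {x : Fin k → Fin n → F} (hx : Function.Injective x)
    (B : Finset (Fin k)) (hB : B.card = 4)
    (hap : ∀ r, ∑ t, ap4 F r t • x (B.orderIsoOfFin hB t).1 = 0) :
    ∑ P : apVanishing F n, esymmFun (fun i => testFun ψ P.1 (x i)) 4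
      ≤ -(Fintype.card (apVanishing F n) / 8 ^ 4) := by
  simp only [esymmFun]
  rw [Finset.sum_comm, ← Finset.add_sum_erase _ _
    (Finset.mem_powersetCard.2 ⟨Finset.subset_univ B, hB⟩)]
  have hmain : ∑ P : apVanishing F n, ∏ i ∈ B, testFun ψ P.1 (x i)
      ≤ -(Fintype.card (apVanishing F n) / 8 ^ 4) := by
    simp only [prod_finset_eq_prod_fin B hB]
    exact sum_prod_testFun_fourAP h2 h3 hψ (injective_comp_orderIsoOfFin B hB hx) hap
  have hrest : ∀ C ∈ (Finset.powersetCard 4 (Finset.univ : Finset (Fin k))).erase B,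
      ∑ P : apVanishing F n, ∏ i ∈ C, testFun ψ P.1 (x i) ≤ 0 := by
    intro C hC
    have hC := (Finset.mem_powersetCard.1 (Finset.mem_of_mem_erase hC)).2
    simp only [prod_finset_eq_prod_fin C hC]
    exact sum_prod_testFun_four_nonpos h2 h3 hψ (injective_comp_orderIsoOfFin C hC hx)
  linarith [Finset.sum_nonpos hrest]

theorem sum_prod_half_le [Fintype (apVanishing F n)] (h2 : (2 : F) ≠ 0) (h3 : (3 : F) ≠ 0)
    {ψ : AddChar F ℂ} (hψ : ψ ≠ 0) {x : Fin k → Fin n → F} (hx : Function.Injective x)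
    (hk : 4 ≤ k) (B : Finset (Fin k)) (hB : B.card = 4)
    (hap : ∀ r, ∑ t, ap4 F r t • x (B.orderIsoOfFin hB t).1 = 0)
    {ε : ℝ} (hε : 0 ≤ ε) (hε1 : ε ≤ 1) :
    ∑ P : apVanishing F n, (∏ i, (1 / 2 + ε * testFun ψ P.1 (x i))
        + ∏ i, (1 / 2 - ε * testFun ψ P.1 (x i))) ≤
      Fintype.card (apVanishing F n) *
        (2 * (1 / 2) ^ k - 2 * (1 / 2) ^ (k - 4) / 8 ^ 4 * ε ^ 4 + 2 ^ (k + 1) * ε ^ 5) := by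
  refine (Finset.sum_le_sum fun P _ =>
    prod_half_add_add_prod_half_sub_le hk (fun i => abs_testFun_le ψ P.1 (x i)) hε hε1).trans ?_
  simp only [Finset.sum_add_distrib, ← Finset.mul_sum, sum_esymmFun_two h2 h3 hψ hx,
    Finset.sum_const, Finset.card_univ, nsmul_eq_mul]
  have h4 := mul_le_mul_of_nonneg_left (sum_esymmFun_four_le h2 h3 hψ hx B hB hap)
    (show 0 ≤ 2 * ε ^ 4 * (1 / 2 : ℝ) ^ (k - 4) by positivity)
  refine (add_le_add_left (add_le_add_right h4 _) _).trans (le_of_eq ?_)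
  ring

end Averaging

theorem two_ne_zero_of_odd_card {F : Type} [Field F] [Fintype F]
    (hq : Odd (Fintype.card F)) : (2 : F) ≠ 0 :=
  Ring.two_ne_zero fun h => by
    have := FiniteField.even_card_of_char_two h
    rw [Nat.odd_iff] at hq
    omega

section Uncommon

variable {F : Type} [Field F]

theorem three_ne_zero_of_induces_fourAP {m k : ℕ} {L : Matrix (Fin m) (Fin k) F}
    (hirr : IsIrredundant L) {B : Finset (Fin k)} {hB : B.card = 4}
    (hind : InducesOn L (ap4 F) B hB) : (3 : F) ≠ 0 := by
  intro h3
  refine hirr ⟨(B.orderIsoOfFin hB 0).1, (B.orderIsoOfFin hB 3).1, fun h => ?_, fun x hx => ?_⟩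
  · exact absurd ((B.orderIsoOfFin hB).injective (Subtype.ext h)) (by decide)
  · have h0 := hind x hx 0
    have h1 := hind x hx 1
    simp only [ap4, Fin.sum_univ_four] at h0 h1
    simp [-Finset.coe_orderIsoOfFin_apply] at h0 h1
    linear_combination (-2) * h0 - h1 +
      (x (B.orderIsoOfFin hB 0).1 - x (B.orderIsoOfFin hB 1).1) * h3

variable [Fintype F] [DecidableEq F]

theorem fourAP_of_mem_solutions {m k n : ℕ} {L : Matrix (Fin m) (Fin k) F}
    {B : Finset (Fin k)} {hB : B.card = 4} (hind : InducesOn L (ap4 F) B hB)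
    {x : Fin k → Fin n → F} (hx : x ∈ solutions L n) (r : Fin 2) :
    ∑ t, ap4 F r t • x (B.orderIsoOfFin hB t).1 = 0 := by
  funext a
  have h := hind (fun j => x j a) (fun i => ?_) r
  · simpa using h
  · have := congrFun ((Finset.mem_filter.1 hx).2 i) a
    simpa using this

theorem deltaSol_mul_card {m k n : ℕ} (L : Matrix (Fin m) (Fin k) F) (f : (Fin n → F) → ℝ) :
    deltaSol L f * (solutions L n).card =
      ∑ x ∈ solutions L n, (∏ i, (1 / 2 + f (x i)) + ∏ i, (1 / 2 - f (x i))) := by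
  have h0 : ((solutions L n).card : ℝ) ≠ 0 := by
    refine Nat.cast_ne_zero.2 (Finset.card_ne_zero.2 ⟨0, ?_⟩)
    simp [solutions]
  rw [deltaSol, lambdaSol, lambdaSol, ← add_div, div_mul_cancel₀ _ h0, Finset.sum_add_distrib]

end Uncommon

/-- any irredundant `(m × k)`-system over an odd prime power field that
induces a 4-AP as a subsystem is uncommon. -/
theorem uncommon_of_induces_fourAP
    {F : Type} [Field F] [Fintype F] [DecidableEq F] (hq : Odd (Fintype.card F))
    {m k : ℕ} (hm : 2 ≤ m) (hmk : m < k)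
    (L : Matrix (Fin m) (Fin k) F) (hL : RowsIndep L) (hirr : IsIrredundant L)
    (hsub : ∃ (B : Finset (Fin k)) (hB : B.card = 4), InducesOn L (ap4 F) B hB) :
    ¬ IsCommon L := by
  classical
  intro hcom
  obtain ⟨B, hB, hind⟩ := hsub
  have hk : 4 ≤ k := by
    rw [← hB]
    exact B.card_le_univ.trans (Fintype.card_fin k).le
  have h2 := two_ne_zero_of_odd_card hq
  have h3 := three_ne_zero_of_induces_fourAP hirr hind
  obtain ⟨ψ, hψ1⟩ := AddChar.exists_apply_ne_zero.2 (one_ne_zero : (1 : F) ≠ 0)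
  have hψ : ψ ≠ 0 := by
    rintro rfl
    exact hψ1 rfl
  set δ : ℝ := 2 * (1 / 2) ^ (k - 4) / 8 ^ 4 with hδ
  have hδ0 : 0 < δ := by positivity
  have hδ1 : δ ≤ 1 := by
    have : (1 / 2 : ℝ) ^ (k - 4) ≤ 1 := pow_le_one₀ (by norm_num) (by norm_num)
    rw [hδ, div_le_one (by positivity)]
    linarith
  set ε : ℝ := δ / 2 ^ (k + 2) with hε
  have hε0 : 0 < ε := by positivity
  have hε1 : ε ≤ 1 / 2 := by
    have : (2 : ℝ) ≤ 2 ^ (k + 2) := le_self_pow₀ one_le_two (by omega)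
    rw [hε, div_le_iff₀ (by positivity)]
    linarith
  set η : ℝ := δ / 2 * ε ^ 4 with hη
  have hη0 : 0 < η := by positivity
  have hgap : δ * ε ^ 4 - 2 ^ (k + 1) * ε ^ 5 = η := by
    have : 2 ^ (k + 1) * ε = δ / 2 := by
      rw [hε]
      field_simp
      ring
    rw [hη]
    linear_combination (-ε ^ 4) * this
  have hq1 : (1 : ℝ) < Fintype.card F := by exact_mod_cast Fintype.one_lt_card
  have hη1 : η ≤ 1 := by
    have : ε ^ 4 ≤ 1 := pow_le_one₀ hε0.le (by linarith)
    rw [hη]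
    nlinarith
  obtain ⟨n₀, hn₀⟩ := pow_unbounded_of_one_lt (k ^ 2 * 3 / η) hq1
  obtain ⟨n, hn1, hn⟩ : ∃ n, 1 ≤ n ∧ (k ^ 2 * 3 / η : ℝ) < (Fintype.card F : ℝ) ^ n :=
    ⟨n₀ + 1, by omega, hn₀.trans_le (pow_le_pow_right₀ hq1.le (by omega))⟩
  rw [div_lt_iff₀ hη0] at hn
  set S := solutions L n with hS
  have hS0 : 0 < (S.card : ℝ) :=
    Nat.cast_pos.2 (Finset.card_pos.2 ⟨0, by simp [hS, solutions]⟩)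
  let R := apVanishing F n
  have hR0 : 0 < (Fintype.card R : ℝ) := Nat.cast_pos.2 Fintype.card_pos
  let T : R → (Fin k → Fin n → F) → ℝ := fun P x =>
    ∏ i, (1 / 2 + ε * testFun ψ P.1 (x i)) + ∏ i, (1 / 2 - ε * testFun ψ P.1 (x i))
  set c : ℝ := 2 * (1 / 2) ^ k with hc
  have hc0 : 0 ≤ c := by positivity
  have hzpow : (2 : ℝ) ^ (1 - (k : ℤ)) = c := by
    rw [zpow_sub₀ two_ne_zero, zpow_one, zpow_natCast, hc, one_div, inv_pow, div_eq_mul_inv]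
  have hlower : Fintype.card R * (c * S.card) ≤ ∑ x ∈ S, ∑ P, T P x := by
    rw [Finset.sum_comm, ← nsmul_eq_mul, ← Finset.card_univ]
    refine Finset.card_nsmul_le_sum _ _ _ fun P _ => ?_
    have hbound : ∀ z, ε * testFun ψ P.1 z ∈ Set.Icc (-(1 / 2) : ℝ) (1 / 2) := fun z => by
      rw [Set.mem_Icc, ← abs_le, abs_mul, abs_of_pos hε0]
      calc ε * |testFun ψ P.1 z| ≤ 1 / 2 * 1 := by gcongr; exact abs_testFun_le ψ P.1 z
        _ = 1 / 2 := mul_one _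
    have h := hcom n hn1 (fun z => ε * testFun ψ P.1 z) hbound
    rw [hzpow] at h
    rw [← deltaSol_mul_card L fun z => ε * testFun ψ P.1 z]
    gcongr
  have hgood : ∀ x ∈ S.filter fun x => Function.Injective x,
      ∑ P, T P x ≤ Fintype.card R * (c - η) := by
    intro x hx
    obtain ⟨hxS, hx⟩ := Finset.mem_filter.1 hx
    refine (sum_prod_half_le h2 h3 hψ hx hk B hB (fourAP_of_mem_solutions hind hxS) hε0.le
      (by linarith)).trans (le_of_eq ?_)
    rw [← hgap]
    ring
  have hbad : ∀ x ∈ S.filter fun x => ¬ Function.Injective x,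
      ∑ P, T P x ≤ Fintype.card R * 2 := by
    intro x _
    rw [← nsmul_eq_mul, ← Finset.card_univ]
    exact Finset.sum_le_card_nsmul _ _ _ fun P _ =>
      prod_half_add_add_prod_half_sub_le_two (fun i => abs_testFun_le ψ P.1 (x i)) hε0.le hε1
  have hupper := add_le_add (Finset.sum_le_card_nsmul _ _ _ hgood)
    (Finset.sum_le_card_nsmul _ _ _ hbad)
  rw [Finset.sum_filter_add_sum_filter_not, nsmul_eq_mul, nsmul_eq_mul] at hupper
  have hcard := S.card_filter_add_card_filter_not fun x => Function.Injective x
  have hcoll := card_not_injective_mul_le hirr n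
  rw [← hS] at hcoll
  set g := (S.filter fun x => Function.Injective x).card
  set b := (S.filter fun x => ¬ Function.Injective x).card
  have hcard : (g : ℝ) + b = S.card := by exact_mod_cast hcard
  have hcoll : (b : ℝ) * (Fintype.card F : ℝ) ^ n ≤ k ^ 2 * S.card := by exact_mod_cast hcoll
  have hb0 : (0 : ℝ) ≤ b := Nat.cast_nonneg _
  have hqn : (0 : ℝ) < (Fintype.card F : ℝ) ^ n := by positivity
  have hfew : 3 * (b : ℝ) < η * S.card := by
    refine lt_of_mul_lt_mul_right ?_ hqn.le
    calc 3 * (b : ℝ) * (Fintype.card F : ℝ) ^ n ≤ k ^ 2 * 3 * S.card := by linarith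
      _ < (Fintype.card F : ℝ) ^ n * η * S.card := by gcongr
      _ = _ := by ring
  have hfinal : (g : ℝ) * (c - η) + b * 2 < c * S.card := by
    rw [← hcard] at hfew ⊢
    nlinarith [mul_nonneg hb0 hc0, mul_nonneg hb0 (sub_nonneg.2 hη1)]
  have := mul_lt_mul_of_pos_left hfinal hR0
  linarith
end

section
/- Let q be a prime power, let 2 ≤ m < k be integers, and let L be an (m×k)-system over F_q such that s(L) is even. If every single-equation system of length s(L) induced by L is uncommon, then L is uncommon. -/
open Finset

section Fourier

lemma map_sum_addChar {A ι : Type*} [AddCommGroup A] (χ : AddChar A ℂ) (S : Finset ι) (v : ι → A) :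
    χ (∑ i ∈ S, v i) = ∏ i ∈ S, χ (v i) := by
  classical
  induction S using Finset.induction_on with
  | empty => simp
  | insert i S hi ih => rw [sum_insert hi, prod_insert hi, AddChar.map_add_eq_mul, ih]

variable {F : Type} [Field F] [Fintype F] [DecidableEq F]

/-- `R` annihilates every solution of `L x = 0`. -/
def Annihilates {m k n : ℕ} (L : Matrix (Fin m) (Fin k) F) (R : Fin k → Fin n → F) : Prop :=
  ∀ x ∈ solutions L n, ∑ j, R j ⬝ᵥ x j = 0

lemma mem_solutions {m k n : ℕ} {L : Matrix (Fin m) (Fin k) F} {x : Fin k → Fin n → F} :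
    x ∈ solutions L n ↔ ∀ i, ∑ j, L i j • x j = 0 := by
  simp [solutions]

lemma zero_mem_solutions {m k : ℕ} (L : Matrix (Fin m) (Fin k) F) (n : ℕ) :
    (0 : Fin k → Fin n → F) ∈ solutions L n := by
  simp [mem_solutions]

lemma add_mem_solutions {m k n : ℕ} {L : Matrix (Fin m) (Fin k) F} {x y : Fin k → Fin n → F}
    (hx : x ∈ solutions L n) (hy : y ∈ solutions L n) : x + y ∈ solutions L n := by
  rw [mem_solutions] at *
  intro i
  simp [smul_add, sum_add_distrib, hx i, hy i]

lemma smul_mem_solutions {m k n : ℕ} {L : Matrix (Fin m) (Fin k) F} {x : Fin k → Fin n → F}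
    (a : F) (hx : x ∈ solutions L n) : a • x ∈ solutions L n := by
  rw [mem_solutions] at *
  intro i
  have : ∀ j, L i j • (a • x) j = a • (L i j • x j) := fun j => by
    rw [Pi.smul_apply, smul_comm]
  simp only [this, ← smul_sum, hx i, smul_zero]

open Classical in
lemma sum_addChar_solutions {m k n : ℕ} (L : Matrix (Fin m) (Fin k) F) {χ : AddChar F ℂ}
    {u : F} (hu : χ u ≠ 1) (R : Fin k → Fin n → F) :
    ∑ x ∈ solutions L n, χ (∑ j, R j ⬝ᵥ x j) =
      if Annihilates L R then ((solutions L n).card : ℂ) else 0 := by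
  split_ifs with h
  · rw [sum_congr rfl fun x hx => by rw [h x hx]]
    simp
  · simp only [Annihilates, not_forall] at h
    obtain ⟨x₀, hx₀, hne⟩ := h
    set v := ∑ j, R j ⬝ᵥ x₀ j with hv
    set z : Fin k → Fin n → F := (u * v⁻¹) • x₀ with hz
    have hzm : z ∈ solutions L n := smul_mem_solutions _ hx₀
    have hzv : ∑ j, R j ⬝ᵥ z j = u := by
      simp only [hz, Pi.smul_apply, dotProduct_smul]
      rw [← smul_sum, ← hv, smul_eq_mul, mul_assoc, inv_mul_cancel₀ hne, mul_one]
    have key : ∑ x ∈ solutions L n, χ (∑ j, R j ⬝ᵥ x j) =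
        χ u * ∑ x ∈ solutions L n, χ (∑ j, R j ⬝ᵥ x j) := by
      rw [mul_sum]
      symm
      refine sum_equiv (Equiv.addRight z) (fun x => ⟨fun hx => add_mem_solutions hx hzm,
        fun hx => ?_⟩) fun x _ => ?_
      · have := add_mem_solutions hx (smul_mem_solutions (-1) hzm)
        simpa using this
      · simp only [Equiv.coe_addRight, Pi.add_apply, dotProduct_add, sum_add_distrib, hzv,
          AddChar.map_add_eq_mul, mul_comm]
    have : (1 - χ u) * ∑ x ∈ solutions L n, χ (∑ j, R j ⬝ᵥ x j) = 0 := by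
      rw [sub_mul, one_mul, ← key, sub_self]
    exact (mul_eq_zero.1 this).resolve_left (sub_ne_zero.2 hu.symm)

open Classical in
lemma lambdaSol_eq_sum_annihilates {m k n : ℕ} (L : Matrix (Fin m) (Fin k) F) {χ : AddChar F ℂ}
    {u : F} (hu : χ u ≠ 1) {g : (Fin n → F) → ℝ} {a : (Fin n → F) → ℂ}
    (hg : ∀ y, (g y : ℂ) = ∑ r, a r * χ (r ⬝ᵥ y)) :
    (lambdaSol L g : ℂ) =
      ∑ R : Fin k → Fin n → F with Annihilates L R, ∏ j, a (R j) := by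
  have hcard : ((solutions L n).card : ℂ) ≠ 0 :=
    Nat.cast_ne_zero.2 (card_ne_zero_of_mem (zero_mem_solutions L n))
  rw [lambdaSol]
  push_cast
  rw [div_eq_iff hcard]
  have expand : ∀ x : Fin k → Fin n → F, ∏ j, (g (x j) : ℂ) =
      ∑ R : Fin k → Fin n → F, (∏ j, a (R j)) * χ (∑ j, R j ⬝ᵥ x j) := fun x => by
    simp only [hg]
    rw [Finset.prod_univ_sum, Fintype.piFinset_univ]
    refine sum_congr rfl fun R _ => ?_
    rw [prod_mul_distrib, map_sum_addChar]
  simp only [expand]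
  rw [sum_comm, sum_filter, sum_mul]
  refine sum_congr rfl fun R _ => ?_
  rw [← mul_sum, sum_addChar_solutions L hu]
  split_ifs <;> simp

lemma sum_addChar_dotProduct {n : ℕ} {χ : AddChar F ℂ} {u : F} (hu : χ u ≠ 1) (z : Fin n → F) :
    ∑ r : Fin n → F, χ (r ⬝ᵥ z) = if z = 0 then (Fintype.card (Fin n → F) : ℂ) else 0 := by
  split_ifs with h
  · simp [h]
  · obtain ⟨i, hi⟩ := Function.ne_iff.1 h
    set w : Fin n → F := Pi.single i (u * (z i)⁻¹) with hw
    have hwz : w ⬝ᵥ z = u := by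
      rw [hw, single_dotProduct, mul_assoc, inv_mul_cancel₀ hi, mul_one]
    have key : ∑ r : Fin n → F, χ (r ⬝ᵥ z) = χ u * ∑ r : Fin n → F, χ (r ⬝ᵥ z) := by
      rw [mul_sum]
      symm
      refine Fintype.sum_equiv (Equiv.addRight w) _ _ fun r => ?_
      simp only [Equiv.coe_addRight, add_dotProduct, hwz, AddChar.map_add_eq_mul, mul_comm]
    have : (1 - χ u) * ∑ r : Fin n → F, χ (r ⬝ᵥ z) = 0 := by
      rw [sub_mul, one_mul, ← key, sub_self]
    exact (mul_eq_zero.1 this).resolve_left (sub_ne_zero.2 hu.symm)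

open ComplexConjugate in
lemma exists_fourier_expansion {n : ℕ} {χ : AddChar F ℂ} {u : F} (hu : χ u ≠ 1)
    (g : (Fin n → F) → ℝ) :
    ∃ a : (Fin n → F) → ℂ, (∀ r, a (-r) = conj (a r)) ∧
      a 0 = (((∑ y, g y) / Fintype.card (Fin n → F) : ℝ) : ℂ) ∧
      ∀ y, (g y : ℂ) = ∑ r, a r * χ (r ⬝ᵥ y) := by
  refine ⟨fun r => (∑ y, (g y : ℂ) * χ (-(r ⬝ᵥ y))) / Fintype.card (Fin n → F), fun r => ?_, ?_,
    fun y => ?_⟩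
  · simp only [map_div₀, map_sum, map_mul, Complex.conj_ofReal, Complex.conj_natCast,
      ← AddChar.map_neg_eq_conj, neg_dotProduct]
  · simp
  · have hcard : (Fintype.card (Fin n → F) : ℂ) ≠ 0 := Nat.cast_ne_zero.2 Fintype.card_ne_zero
    have swap : ∀ r : Fin n → F,
        (∑ z, (g z : ℂ) * χ (-(r ⬝ᵥ z))) / Fintype.card (Fin n → F) * χ (r ⬝ᵥ y) =
          ∑ z, (g z : ℂ) / Fintype.card (Fin n → F) * χ (r ⬝ᵥ (y - z)) := fun r => by
      rw [sum_div, sum_mul]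
      refine sum_congr rfl fun z _ => ?_
      rw [dotProduct_sub, sub_eq_neg_add, AddChar.map_add_eq_mul]
      ring
    simp only [swap]
    rw [sum_comm]
    simp only [← mul_sum, sum_addChar_dotProduct hu, sub_eq_zero, mul_ite, mul_zero]
    rw [sum_ite_eq univ y]
    simp

end Fourier

section Pairing

variable {F : Type} [Field F] [DecidableEq F]

open ComplexConjugate in
/-- If every odd `ZMod (2 * (s + 1))`-valued weight sums to zero along `c`, then the values of `c`
cancel in pairs, so products of Hermitian functions along `c` are nonnegative. -/
lemma exists_nonneg_prod_eq {ι : Type*} [DecidableEq ι] {s : ℕ} (c : ι → F) {b : F → ℂ}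
    (hb : ∀ v, b (-v) = conj (b v)) (S : Finset ι) (hS : S.card ≤ s)
    (h : ∀ φ : F → ZMod (2 * (s + 1)), (∀ v, φ (-v) = -φ v) → ∑ i ∈ S, φ (c i) = 0) :
    ∃ x : ℝ, 0 ≤ x ∧ ∏ i ∈ S, b (c i) = x := by
  induction S using Finset.strongInduction with
  | H S ih =>
    rcases S.eq_empty_or_nonempty with rfl | ⟨i, hi⟩
    · exact ⟨1, zero_le_one, by simp⟩
    have hpair : ∃ j ∈ S.erase i, c j = -c i := by
      by_contra! hno
      have hdvd : ∀ t : ℕ, 0 < t → t < 2 * (s + 1) → (t : ZMod (2 * (s + 1))) ≠ 0 :=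
        fun t h0 ht h => absurd (Nat.le_of_dvd h0 ((ZMod.natCast_eq_zero_iff _ _).1 h)) (by omega)
      by_cases hself : c i = -c i
      · have := h (fun v => if v = c i then ((s + 1 : ℕ) : ZMod (2 * (s + 1))) else 0) fun v => by
          have : -v = c i ↔ v = c i := by rw [neg_eq_iff_eq_neg, ← hself]
          simp only [this]
          split_ifs
          · rw [eq_neg_iff_add_eq_zero, ← Nat.cast_add, ZMod.natCast_eq_zero_iff]
            exact ⟨1, by ring⟩
          · simp
        rw [← add_sum_erase _ _ hi, if_pos rfl, sum_eq_zero, add_zero] at this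
        · exact hdvd _ (by omega) (by omega) this
        · intro j hj
          exact if_neg fun e => hno j hj (e.trans hself)
      · have := h (fun v => if v = c i then 1 else if v = -c i then -1 else 0) fun v => by
          have h1 : -v = c i ↔ v = -c i := neg_eq_iff_eq_neg
          simp only [h1, neg_inj]
          by_cases e1 : v = c i
          · have : v ≠ -c i := fun e => hself (e1.symm.trans e)
            simp [e1, hself]
          · by_cases e2 : v = -c i <;> simp [e1, e2, Ne.symm hself]
        have hcount : ∑ j ∈ S, (if c j = c i then (1 : ZMod (2 * (s + 1)))
            else if c j = -c i then -1 else 0) = ((S.filter fun j => c j = c i).card : ℕ) := by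
          rw [card_filter, Nat.cast_sum]
          refine sum_congr rfl fun j hj => ?_
          by_cases e : c j = c i
          · simp [e]
          · have : c j ≠ -c i := hno j (mem_erase.2 ⟨fun e' => e (by rw [e']), hj⟩)
            simp [e, this]
        rw [hcount] at this
        refine hdvd _ (card_pos.2 ⟨i, by simp [hi]⟩) ?_ this
        have := card_filter_le S fun j => c j = c i
        omega
    obtain ⟨j, hj, hji⟩ := hpair
    obtain ⟨x, hx, hprod⟩ := ih ((S.erase i).erase j)
      ((erase_subset _ _).trans_ssubset (erase_ssubset hi))
      ((card_le_card ((erase_subset _ _).trans (erase_subset _ _))).trans hS) fun φ hφ => by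
        have := h φ hφ
        rw [← add_sum_erase _ _ hi, ← add_sum_erase _ _ hj, hji, hφ] at this
        simpa using this
    refine ⟨Complex.normSq (b (c i)) * x, mul_nonneg (Complex.normSq_nonneg _) hx, ?_⟩
    rw [← mul_prod_erase _ _ hi, ← mul_prod_erase _ _ hj, hprod, hji, hb, ← mul_assoc,
      Complex.mul_conj]
    push_cast
    rfl

end Pairing

section SingleEquation

variable {F : Type} [Field F] [Fintype F] [DecidableEq F]

lemma Annihilates.eq_smul {s n : ℕ} {c : Fin s → F} {j₀ : Fin s} (hc : c j₀ ≠ 0)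
    {R : Fin s → Fin n → F} (hR : Annihilates (Matrix.of fun _ : Fin 1 => c) R) (i : Fin s) :
    R i = c i • ((c j₀)⁻¹ • R j₀) := by
  ext l
  have hx := hR (Pi.single i (Pi.single l (c j₀)) - Pi.single j₀ (Pi.single l (c i))) (by
    rw [mem_solutions]
    intro _
    simp only [Matrix.of_apply, Pi.sub_apply, smul_sub, sum_sub_distrib, Pi.single_apply, smul_ite,
      smul_zero, sum_ite_eq', mem_univ, if_true]
    rw [← Pi.single_smul, ← Pi.single_smul, smul_eq_mul, smul_eq_mul, mul_comm, sub_self])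
  have hsum : ∀ (i : Fin s) (v : Fin n → F),
      ∑ j, R j ⬝ᵥ (Pi.single i v : Fin s → Fin n → F) j = R i ⬝ᵥ v := fun i v => by
    rw [sum_eq_single i (fun j _ hj => by simp [hj]) (by simp), Pi.single_eq_same]
  simp only [Pi.sub_apply, dotProduct_sub, sum_sub_distrib, hsum, dotProduct_single] at hx
  simp only [Pi.smul_apply, smul_eq_mul]
  field_simp
  linear_combination hx

open ComplexOrder in
lemma mean_pow_le_lambdaSol {s n : ℕ} {c : Fin s → F} {j₀ : Fin s} (hc : c j₀ ≠ 0)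
    (h : ∀ φ : F → ZMod (2 * (s + 1)), (∀ v, φ (-v) = -φ v) → ∑ i, φ (c i) = 0)
    (g : (Fin n → F) → ℝ) :
    ((∑ y, g y) / Fintype.card (Fin n → F)) ^ s ≤ lambdaSol (Matrix.of fun _ : Fin 1 => c) g := by
  classical
  obtain ⟨χ, hχ⟩ := AddChar.exists_apply_ne_zero.2 (one_ne_zero : (1 : F) ≠ 0)
  obtain ⟨a, ha, ha0, hg⟩ := exists_fourier_expansion hχ g
  rw [← Complex.real_le_real, lambdaSol_eq_sum_annihilates _ hχ hg, Complex.ofReal_pow, ← ha0]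
  have hmem : (0 : Fin s → Fin n → F) ∈
      univ.filter (Annihilates (Matrix.of fun _ : Fin 1 => c)) := by
    simp [Annihilates]
  refine le_of_eq_of_le ?_ (single_le_sum (f := fun R : Fin s → Fin n → F => ∏ j, a (R j))
    (fun R hR => ?_) hmem)
  · simp
  · have hR' := (mem_filter.1 hR).2.eq_smul hc
    obtain ⟨x, hx, hprod⟩ := exists_nonneg_prod_eq c (b := fun v => a (v • ((c j₀)⁻¹ • R j₀)))
      (fun v => by rw [neg_smul, ha]) univ (by simp) h
    simp only [← hR'] at hprod
    simp only [hprod]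
    exact_mod_cast hx

lemma isCommon_of_forall_odd_sum_eq_zero {s : ℕ} {c : Fin s → F} {j₀ : Fin s} (hc : c j₀ ≠ 0)
    (h : ∀ φ : F → ZMod (2 * (s + 1)), (∀ v, φ (-v) = -φ v) → ∑ i, φ (c i) = 0) :
    IsCommon (Matrix.of fun _ : Fin 1 => c) := by
  intro n _ f hf
  have hcard : (0 : ℝ) < Fintype.card (Fin n → F) := Nat.cast_pos.2 Fintype.card_pos
  refine le_trans ?_ (add_le_add (mean_pow_le_lambdaSol hc h fun y => 1 / 2 + f y)
    (mean_pow_le_lambdaSol hc h fun y => 1 / 2 - f y))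
  set p := (∑ y, (1 / 2 + f y)) / (Fintype.card (Fin n → F) : ℝ) with hp
  set r := (∑ y, (1 / 2 - f y)) / (Fintype.card (Fin n → F) : ℝ) with hr
  have hp0 : 0 ≤ p := div_nonneg (sum_nonneg fun y _ => by linarith [(hf y).1]) hcard.le
  have hr0 : 0 ≤ r := div_nonneg (sum_nonneg fun y _ => by linarith [(hf y).2]) hcard.le
  have hpr : p + r = 1 := by
    rw [hp, hr, ← add_div, ← sum_add_distrib, div_eq_one_iff_eq hcard.ne',
      sum_congr rfl fun y _ => show (1 / 2 + f y) + (1 / 2 - f y) = 1 by ring]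
    simp
  have hs : 1 ≤ s := Fin.pos j₀
  have hpow := add_pow_le hp0 hr0 s
  rw [hpr, one_pow] at hpow
  have hz : (2 : ℝ) ^ (1 - (s : ℤ)) = (2 ^ (s - 1))⁻¹ := by
    rw [← zpow_natCast, ← zpow_neg]
    congr 1
    omega
  rw [hz, inv_le_iff_one_le_mul₀' (by positivity)]
  exact hpow

end SingleEquation

section Perturbation

variable {F : Type} [Field F] [Fintype F] [DecidableEq F]

open Classical in
lemma lambdaSol_eq_sum_inducedEq {m k : ℕ} (L : Matrix (Fin m) (Fin k) F) {χ : AddChar F ℂ}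
    {u : F} (hu : χ u ≠ 1) {g : (Fin 1 → F) → ℝ} {a : F → ℂ}
    (hg : ∀ y, (g y : ℂ) = ∑ r, a r * χ (r * y 0)) :
    (lambdaSol L g : ℂ) = ∑ c : Fin k → F with InducedEq L c, ∏ j, a (c j) := by
  rw [lambdaSol_eq_sum_annihilates L hu (a := fun r => a (r 0)) fun y => by
    rw [hg]
    exact (Fintype.sum_equiv (Equiv.funUnique (Fin 1) F) _ _ fun r => by
      simp [dotProduct]).symm]
  refine sum_equiv (Equiv.piCongrRight fun _ => Equiv.funUnique (Fin 1) F) (fun R => ?_)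
    fun R _ => by simp
  simp only [mem_filter, mem_univ, true_and]
  constructor
  · intro hR x hx
    have := hR (fun j _ => x j) (mem_solutions.2 fun i => by
      ext l
      simpa using hx i)
    simpa [dotProduct] using this
  · intro hR x hx
    have := hR (fun j => x j 0) fun i => by
      simpa using congrFun (mem_solutions.1 hx i) 0
    simpa [dotProduct] using this

/-- The product of the phases `exp (2πi φ(c j) / N)` over the support of `c`. -/
noncomputable def phaseProd {N k : ℕ} [NeZero N] (φ : F → ZMod N) (c : Fin k → F) : ℂ :=
  ∏ j with c j ≠ 0, ZMod.stdAddChar (φ (c j))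

open Classical in
lemma exists_perturbation {m k N : ℕ} [NeZero N] (L : Matrix (Fin m) (Fin k) F) {φ : F → ZMod N}
    (hφ : ∀ v, φ (-v) = -φ v) :
    ∃ f : (Fin 1 → F) → ℝ, ∀ t : ℝ,
      2 ^ k * lambdaSol L (fun y => 1 / 2 + t * f y) =
        ∑ c : Fin k → F with InducedEq L c, t ^ eqLength c * (phaseProd φ c).re := by
  obtain ⟨χ, hχ⟩ := AddChar.exists_apply_ne_zero.2 (one_ne_zero : (1 : F) ≠ 0)
  set b : F → ℂ := fun r => if r = 0 then 0 else ZMod.stdAddChar (φ r) with hb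
  have hreal : ∀ y : Fin 1 → F,
      (((∑ r, b r * χ (r * y 0)).re : ℝ) : ℂ) = ∑ r, b r * χ (r * y 0) := fun y => by
    rw [← Complex.conj_eq_iff_re, map_sum]
    refine Fintype.sum_equiv (Equiv.neg F) _ _ fun r => ?_
    simp only [hb, Equiv.neg_apply, neg_eq_zero, map_mul, hφ, neg_mul, AddChar.map_neg_eq_conj]
    split_ifs <;> simp
  refine ⟨fun y => (∑ r, b r * χ (r * y 0)).re / 2, fun t => ?_⟩
  have hexp := lambdaSol_eq_sum_inducedEq L hχ
    (g := fun y => 1 / 2 + t * ((∑ r, b r * χ (r * y 0)).re / 2))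
    (a := fun r => 1 / 2 * if r = 0 then 1 else t * ZMod.stdAddChar (φ r)) fun y => by
      push_cast
      rw [hreal, ← add_sum_erase univ _ (mem_univ (0 : F)),
        ← add_sum_erase univ (fun r => _ * χ (r * y 0)) (mem_univ (0 : F))]
      simp only [hb, if_true, zero_mul, AddChar.map_zero_eq_one, zero_add, mul_one]
      rw [sum_div, mul_sum]
      congr 1
      refine sum_congr rfl fun r hr => ?_
      rw [if_neg (ne_of_mem_erase hr), if_neg (ne_of_mem_erase hr)]
      ring
  have hterm : ∀ c : Fin k → F,
      ∏ j, ((1 / 2 : ℂ) * if c j = 0 then 1 else t * ZMod.stdAddChar (φ (c j))) =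
        (1 / 2) ^ k * ((t ^ eqLength c : ℝ) * phaseProd φ c) := fun c => by
    rw [prod_mul_distrib, prod_const, card_univ, Fintype.card_fin, prod_ite, prod_const_one,
      one_mul, prod_mul_distrib, prod_const, phaseProd, eqLength]
    push_cast
    rfl
  simp only [hterm, ← mul_sum] at hexp
  have h2 : (2 : ℂ) ^ k * (1 / 2) ^ k = 1 := by rw [← mul_pow]; norm_num
  beta_reduce
  generalize lambdaSol L (fun y : Fin 1 → F => 1 / 2 + t * ((∑ r, b r * χ (r * y 0)).re / 2)) =
    l at hexp ⊢
  have hl : ((2 ^ k * l : ℝ) : ℂ) =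
      ∑ c : Fin k → F with InducedEq L c, (t ^ eqLength c : ℝ) * phaseProd φ c := by
    push_cast at hexp ⊢
    rw [hexp, ← mul_assoc, h2, one_mul]
  rw [← Complex.ofReal_re (2 ^ k * l), hl, Complex.re_sum]
  simp only [Complex.re_ofReal_mul]

lemma sum_phaseProd_eq_zero {k N : ℕ} [NeZero N] {c : Fin k → F} {φ₀ : F → ZMod N}
    (hφ₀ : ∀ v, φ₀ (-v) = -φ₀ v) (hne : ∑ j with c j ≠ 0, φ₀ (c j) ≠ 0) :
    ∑ φ : F → ZMod N with ∀ v, φ (-v) = -φ v, phaseProd φ c = 0 := by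
  have key : ∑ φ : F → ZMod N with ∀ v, φ (-v) = -φ v, phaseProd φ c =
      ZMod.stdAddChar (∑ j with c j ≠ 0, φ₀ (c j)) *
        ∑ φ : F → ZMod N with ∀ v, φ (-v) = -φ v, phaseProd φ c := by
    rw [mul_sum]
    symm
    refine sum_equiv (Equiv.addRight φ₀) (fun φ => ?_) fun φ _ => ?_
    · simp only [mem_filter, mem_univ, true_and, Equiv.coe_addRight, Pi.add_apply, hφ₀, neg_add,
        add_left_inj]
    · simp only [phaseProd, map_sum_addChar, Equiv.coe_addRight, Pi.add_apply,
        AddChar.map_add_eq_mul, prod_mul_distrib, mul_comm]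
  have h1 : (ZMod.stdAddChar (∑ j with c j ≠ 0, φ₀ (c j)) : ℂ) ≠ 1 := fun h =>
    hne (ZMod.injective_stdAddChar (h.trans (AddChar.map_zero_eq_one _).symm))
  have : (1 - ZMod.stdAddChar (∑ j with c j ≠ 0, φ₀ (c j))) *
      ∑ φ : F → ZMod N with ∀ v, φ (-v) = -φ v, phaseProd φ c = 0 := by
    rw [sub_mul, one_mul, ← key, sub_self]
  exact (mul_eq_zero.1 this).resolve_left (sub_ne_zero.2 h1.symm)

lemma exists_sum_phaseProd_neg {k N : ℕ} [NeZero N] {C : Finset (Fin k → F)} (hC : C.Nonempty)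
    (h : ∀ c ∈ C, ∃ φ : F → ZMod N, (∀ v, φ (-v) = -φ v) ∧ ∑ j with c j ≠ 0, φ (c j) ≠ 0) :
    ∃ φ : F → ZMod N, (∀ v, φ (-v) = -φ v) ∧ ∑ c ∈ C, (phaseProd φ c).re < 0 := by
  by_contra! hno
  have hzero : ∑ φ : F → ZMod N with ∀ v, φ (-v) = -φ v, ∑ c ∈ C, (phaseProd φ c).re = 0 := by
    rw [sum_comm]
    refine sum_eq_zero fun c hc => ?_
    obtain ⟨φ₀, hφ₀, hne⟩ := h c hc
    rw [← Complex.re_sum, sum_phaseProd_eq_zero hφ₀ hne, Complex.zero_re]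
  rw [sum_eq_zero_iff_of_nonneg fun φ hφ => hno φ (mem_filter.1 hφ).2] at hzero
  have := hzero 0 (by simp)
  simp [phaseProd, hC.ne_empty] at this

end Perturbation

section MinimalLength

variable {F : Type} [Field F] [DecidableEq F]

lemma exists_inducedEq_eqLength_eq_sMin {m k : ℕ} (hm : 0 < m) {L : Matrix (Fin m) (Fin k) F}
    (hL : RowsIndep L) : ∃ c : Fin k → F, c ≠ 0 ∧ InducedEq L c ∧ eqLength c = sMin L :=
  Nat.sInf_mem (s := {s | ∃ c : Fin k → F, c ≠ 0 ∧ InducedEq L c ∧ eqLength c = s})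
    ⟨_, fun j => L ⟨0, hm⟩ j, hL.ne_zero ⟨0, hm⟩, fun _ hx => hx _, rfl⟩

lemma sMin_le_eqLength {m k : ℕ} {L : Matrix (Fin m) (Fin k) F} {c : Fin k → F} (hc : c ≠ 0)
    (h : InducedEq L c) : sMin L ≤ eqLength c :=
  Nat.sInf_le ⟨c, hc, h, rfl⟩

lemma eqLength_pos {k : ℕ} {c : Fin k → F} (hc : c ≠ 0) : 0 < eqLength c := by
  obtain ⟨j, hj⟩ := Function.ne_iff.1 hc
  exact card_pos.2 ⟨j, by simpa using hj⟩

end MinimalLength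

section Main

variable {F : Type} [Field F] [Fintype F] [DecidableEq F]

lemma exists_odd_sum_ne_zero {m k : ℕ} {L : Matrix (Fin m) (Fin k) F}
    (hunc : ∀ (B : Finset (Fin k)) (hB : B.card = sMin L) (c : Fin (sMin L) → F),
      (∀ t, c t ≠ 0) → InducesOn L (Matrix.of fun _ : Fin 1 => c) B hB →
      ¬ IsCommon (Matrix.of fun _ : Fin 1 => c))
    {c : Fin k → F} (hc : InducedEq L c) (hlen : eqLength c = sMin L) (hpos : 0 < sMin L) :
    ∃ φ : F → ZMod (2 * (sMin L + 1)), (∀ v, φ (-v) = -φ v) ∧ ∑ j with c j ≠ 0, φ (c j) ≠ 0 := by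
  set B : Finset (Fin k) := univ.filter fun j => c j ≠ 0 with hBdef
  have hB : B.card = sMin L := hlen
  have hmem : ∀ j, j ∈ B ↔ c j ≠ 0 := fun j => by simp [hBdef]
  have hsum : ∀ {M : Type} [AddCommMonoid M] (g : Fin k → M),
      ∑ t, g (B.orderIsoOfFin hB t).1 = ∑ j ∈ B, g j := fun g => by
    rw [← sum_coe_sort B g]
    exact Fintype.sum_equiv (B.orderIsoOfFin hB).toEquiv _ _ fun t => rfl
  have hne : ∀ t, c (B.orderIsoOfFin hB t).1 ≠ 0 := fun t => (hmem _).1 (B.orderIsoOfFin hB t).2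
  have hnot := hunc B hB (fun t => c (B.orderIsoOfFin hB t).1) hne fun x hx _ => by
    simp only [Matrix.of_apply]
    rw [hsum fun j => c j * x j, ← hc x hx]
    refine sum_subset (subset_univ _) fun j _ hj => ?_
    rw [not_not.1 (mt (hmem j).2 hj), zero_mul]
  by_contra! hall
  refine hnot (isCommon_of_forall_odd_sum_eq_zero (j₀ := ⟨0, hpos⟩) (hne _) fun φ hφ => ?_)
  rw [hsum fun j => φ (c j)]
  exact hall φ hφ

open Classical Filter Topology in
lemma exists_small_sum_lt_two {m k : ℕ} {L : Matrix (Fin m) (Fin k) F} (hs : Even (sMin L))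
    (hpos : 0 < sMin L) {w : (Fin k → F) → ℝ} (hw : w 0 = 1)
    (hneg : ∑ c : Fin k → F with InducedEq L c ∧ eqLength c = sMin L, w c < 0)
    {α : Type*} [Finite α] (f : α → ℝ) :
    ∃ t : ℝ, (∀ y, |t * f y| < 1 / 2) ∧
      ∑ c : Fin k → F with InducedEq L c, (t ^ eqLength c + (-t) ^ eqLength c) * w c < 2 := by
  set I := univ.filter fun c : Fin k → F => InducedEq L c with hI
  have h0 : (0 : Fin k → F) ∈ I := mem_filter.2 ⟨mem_univ _, fun x _ => by simp⟩
  set h : ℝ → ℝ := fun t => ∑ c ∈ I.erase 0,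
    t ^ (eqLength c - sMin L) * ((1 + (-1) ^ eqLength c) * w c) with hh
  have hcont : Continuous h := by fun_prop
  have hle : ∀ c ∈ I.erase 0, sMin L ≤ eqLength c := fun c hc =>
    sMin_le_eqLength (ne_of_mem_erase hc) (mem_filter.1 (mem_of_mem_erase hc)).2
  have hzero : h 0 < 0 := by
    have hset : (univ.filter fun c : Fin k → F => InducedEq L c ∧ eqLength c = sMin L) =
        (I.erase 0).filter fun c => eqLength c = sMin L := by
      ext c
      simp only [hI, mem_filter, mem_univ, true_and, mem_erase]
      refine ⟨fun ⟨h1, h2⟩ => ⟨⟨?_, h1⟩, h2⟩, fun ⟨⟨_, h1⟩, h2⟩ => ⟨h1, h2⟩⟩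
      rintro rfl
      simp [eqLength] at h2
      omega
    have : h 0 = 2 * ∑ c : Fin k → F with InducedEq L c ∧ eqLength c = sMin L, w c := by
      rw [hset, sum_filter, mul_sum]
      refine sum_congr rfl fun c hc => ?_
      split_ifs with he
      · rw [he, Nat.sub_self, pow_zero, hs.neg_one_pow]
        ring
      · have := hle c hc
        rw [zero_pow (by omega)]
        ring
    linarith
  have hev1 : ∀ᶠ t in 𝓝[>] (0 : ℝ), h t < 0 :=
    nhdsWithin_le_nhds (hcont.continuousAt.eventually_lt continuousAt_const hzero)
  have hev2 : ∀ᶠ t in 𝓝[>] (0 : ℝ), ∀ y, |t * f y| < 1 / 2 :=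
    nhdsWithin_le_nhds (eventually_all.2 fun y =>
      ContinuousAt.eventually_lt (f := fun t : ℝ => |t * f y|) (by fun_prop) continuousAt_const
        (by simp))
  obtain ⟨t, ⟨ht1, ht2⟩, ht⟩ := ((hev1.and hev2).and self_mem_nhdsWithin).exists
  refine ⟨t, ht2, ?_⟩
  have hsplit : ∑ c ∈ I, (t ^ eqLength c + (-t) ^ eqLength c) * w c =
      2 + t ^ sMin L * h t := by
    rw [← add_sum_erase _ _ h0, hh, mul_sum]
    congr 1
    · simp [eqLength, hw]
      norm_num
    · refine sum_congr rfl fun c hc => ?_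
      rw [← mul_assoc, ← pow_add, Nat.add_sub_cancel' (hle c hc), neg_pow t]
      ring
  rw [hsplit]
  have := mul_neg_of_pos_of_neg (pow_pos ht (sMin L)) ht1
  linarith

end Main

/-- if `s(L)` is even and every single-equation system of length `s(L)`
induced by `L` is uncommon, then `L` is uncommon. -/
theorem uncommon_of_even_sMin_uncommon_equations
    {F : Type} [Field F] [Fintype F] [DecidableEq F]
    {m k : ℕ} (hm : 2 ≤ m) (hmk : m < k)
    (L : Matrix (Fin m) (Fin k) F) (hL : RowsIndep L) (hs : Even (sMin L))
    (hunc : ∀ (B : Finset (Fin k)) (hB : B.card = sMin L) (c : Fin (sMin L) → F),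
      (∀ t, c t ≠ 0) → InducesOn L (Matrix.of fun _ : Fin 1 => c) B hB →
      ¬ IsCommon (Matrix.of fun _ : Fin 1 => c)) :
    ¬ IsCommon L := by
  classical
  obtain ⟨c₀, hc₀, hind₀, hlen₀⟩ := exists_inducedEq_eqLength_eq_sMin (by omega) hL
  have hpos : 0 < sMin L := hlen₀ ▸ eqLength_pos hc₀
  obtain ⟨φ, hφ, hneg⟩ := exists_sum_phaseProd_neg (N := 2 * (sMin L + 1))
    (C := univ.filter fun c : Fin k → F => InducedEq L c ∧ eqLength c = sMin L)
    ⟨c₀, by simp [hind₀, hlen₀]⟩ fun c hc =>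
      exists_odd_sum_ne_zero hunc (mem_filter.1 hc).2.1 (mem_filter.1 hc).2.2 hpos
  obtain ⟨f, hf⟩ := exists_perturbation L hφ
  obtain ⟨t, hsmall, hlt⟩ := exists_small_sum_lt_two hs hpos (w := fun c => (phaseProd φ c).re)
    (by simp [phaseProd]) hneg f
  intro hcommon
  have hge := hcommon 1 le_rfl (fun y => t * f y) fun y =>
    ⟨(abs_lt.1 (hsmall y)).1.le, (abs_lt.1 (hsmall y)).2.le⟩
  have hp := hf t
  have hn := hf (-t)
  simp only [neg_mul, ← sub_eq_add_neg] at hn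
  simp only [add_mul, sum_add_distrib] at hlt
  rw [← hp, ← hn, ← mul_add] at hlt
  have h2 : (2 : ℝ) ^ k * 2 ^ (1 - (k : ℤ)) = 2 := by
    rw [← zpow_natCast, ← zpow_add₀ two_ne_zero]
    simp
  have := mul_le_mul_of_nonneg_left hge (show (0 : ℝ) ≤ 2 ^ k by positivity)
  rw [h2] at this
  exact absurd hlt (not_lt.2 this)
end

section
/- Let q be a prime power, let 2 ≤ m ≤ k be integers, let L be an (m×k)-system over F_q and let B be a critical set for L. Then for every n ≥ 1, every solution y ∈ sol(L_B; F_q^n) extends to exactly q^{n(k − c(L) − m + m_B)} solutions of L; that is, the number of x ∈ sol(L; F_q^n) whose restriction to the coordinates in B equals y is q^{n(k − c(L) − m + m_B)}. -/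
open Finset

section LinearAlgebra

/-- A nonempty fibre of a linear map has as many elements as the kernel. -/
theorem LinearMap.natCard_fiber_of_mem_range {R V W : Type*} [Ring R] [AddCommGroup V] [Module R V]
    [AddCommGroup W] [Module R W] (f : V →ₗ[R] W) {w : W} (hw : w ∈ LinearMap.range f) :
    Nat.card {v : V // f v = w} = Nat.card (LinearMap.ker f) := by
  obtain ⟨v₀, rfl⟩ := hw
  exact Nat.card_congr ((Equiv.subRight v₀).subtypeEquiv fun v => by simp [sub_eq_zero])

variable {F : Type} [Field F]

/-- The kernel of a matrix with independent rows has the expected dimension. -/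
theorem RowsIndep.finrank_ker_add {m k : ℕ} {L : Matrix (Fin m) (Fin k) F} (hL : RowsIndep L) :
    Module.finrank F (LinearMap.ker L.mulVecLin) + m = k := by
  have hrank : L.rank = m := by
    simpa using LinearIndependent.rank_matrix (M := L) hL
  have h := L.mulVecLin.finrank_range_add_finrank_ker
  rw [Module.finrank_fin_fun] at h
  rw [Matrix.rank] at hrank
  omega

/-- The rows of a matrix acting surjectively on column vectors are linearly independent. -/
theorem rowsIndep_of_surjective {m k : ℕ} {L : Matrix (Fin m) (Fin k) F}
    (hL : Function.Surjective L.mulVecLin) : RowsIndep L := by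
  have hrank : L.rank = m := by
    rw [Matrix.rank, LinearMap.range_eq_top.mpr hL, finrank_top, Module.finrank_fin_fun]
  refine linearIndependent_iff_card_eq_finrank_span.mpr ?_
  rw [Fintype.card_fin, Set.finrank]
  exact hrank.symm.trans L.rank_eq_finrank_span_row

/-- Restriction of the scalar solutions of `L` to the coordinates in `B`. -/
def solutionRestrict {m k : ℕ} (L : Matrix (Fin m) (Fin k) F) (B : Finset (Fin k)) :
    LinearMap.ker L.mulVecLin →ₗ[F] (Fin B.card → F) :=
  (LinearMap.funLeft F F fun t => (B.orderIsoOfFin rfl t).1) ∘ₗ (LinearMap.ker L.mulVecLin).subtype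

/-- `L` induces `L'` on `B` if and only if `L'` vanishes on the restricted solutions of `L`. -/
theorem inducesOn_iff_range_le {m k m' : ℕ} {L : Matrix (Fin m) (Fin k) F} {B : Finset (Fin k)}
    {L' : Matrix (Fin m') (Fin B.card) F} :
    InducesOn L L' B rfl ↔
      LinearMap.range (solutionRestrict L B) ≤ LinearMap.ker L'.mulVecLin := by
  constructor
  · rintro h _ ⟨⟨x, hx⟩, rfl⟩
    rw [LinearMap.mem_ker] at hx ⊢
    exact funext (h x fun i => congrFun hx i)
  · intro h x hx r
    have hx' : x ∈ LinearMap.ker L.mulVecLin := LinearMap.mem_ker.mpr (funext hx)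
    exact congrFun (LinearMap.mem_ker.mp (h ⟨⟨x, hx'⟩, rfl⟩)) r

/-- `m_B` is at least the codimension of the space of restricted solutions. -/
theorem card_le_finrank_range_add_mMax {m k : ℕ} (L : Matrix (Fin m) (Fin k) F)
    (B : Finset (Fin k)) :
    B.card ≤ Module.finrank F (LinearMap.range (solutionRestrict L B)) + mMax L B := by
  set W := LinearMap.range (solutionRestrict L B) with hW
  have hbdd : BddAbove {m' | ∃ L' : Matrix (Fin m') (Fin B.card) F,
      RowsIndep L' ∧ InducesOn L L' B rfl} := by
    refine ⟨B.card, ?_⟩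
    rintro m' ⟨L', hL', -⟩
    have := hL'.finrank_ker_add
    omega
  let g := (Module.finBasis F ((Fin B.card → F) ⧸ W)).equivFun.toLinearMap ∘ₗ W.mkQ
  have hg : (LinearMap.toMatrix' g).mulVecLin = g := Matrix.toLin'_toMatrix' g
  have hle : Module.finrank F ((Fin B.card → F) ⧸ W) ≤ mMax L B := by
    refine le_csSup hbdd ⟨LinearMap.toMatrix' g, rowsIndep_of_surjective ?_,
      inducesOn_iff_range_le.mpr ?_⟩
    · rw [hg]
      exact (Module.finBasis F ((Fin B.card → F) ⧸ W)).equivFun.surjective.comp W.mkQ_surjective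
    · rw [hg, ← hW]
      intro w hw
      have hw₀ : W.mkQ w = 0 := (Submodule.Quotient.mk_eq_zero W).mpr hw
      rw [LinearMap.mem_ker, LinearMap.comp_apply, hw₀, map_zero]
  have h := W.finrank_quotient_add_finrank
  rw [Module.finrank_fin_fun] at h
  omega

/-- A maximal independent induced system cuts out exactly the restricted solutions. -/
theorem range_solutionRestrict_eq_ker {m k : ℕ} {L : Matrix (Fin m) (Fin k) F}
    {B : Finset (Fin k)} {LB : Matrix (Fin (mMax L B)) (Fin B.card) F}
    (hLB : RowsIndep LB) (hLB' : InducesOn L LB B rfl) :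
    LinearMap.range (solutionRestrict L B) = LinearMap.ker LB.mulVecLin := by
  refine Submodule.eq_of_le_of_finrank_le (inducesOn_iff_range_le.mp hLB') ?_
  have h₁ := hLB.finrank_ker_add
  have h₂ := card_le_finrank_range_add_mMax L B
  omega

/-- Solutions of `L` over `F^n` extending `y` are chosen column by column. -/
def extensionsEquivPi [Fintype F] [DecidableEq F] {m k n : ℕ} (L : Matrix (Fin m) (Fin k) F)
    (B : Finset (Fin k)) (y : Fin B.card → Fin n → F) :
    {x : Fin k → Fin n → F // x ∈ solutions L n ∧ ∀ t, x (B.orderIsoOfFin rfl t).1 = y t} ≃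
      ∀ i : Fin n, {v : LinearMap.ker L.mulVecLin // solutionRestrict L B v = fun t => y t i} where
  toFun x i := ⟨⟨fun j => x.1 j i, by
    have hx := (Finset.mem_filter.mp x.2.1).2
    refine LinearMap.mem_ker.mpr (funext fun r => ?_)
    simpa [Matrix.mulVec, dotProduct] using congrFun (hx r) i⟩,
    funext fun t => congrFun (x.2.2 t) i⟩
  invFun v := ⟨fun j i => (v i).1.1 j, by
    refine ⟨Finset.mem_filter.mpr ⟨Finset.mem_univ _, fun r => funext fun i => ?_⟩,
      fun t => funext fun i => congrFun (v i).2 t⟩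
    have hv : ∑ j, L r j * (v i).1.1 j = 0 := congrFun (LinearMap.mem_ker.mp (v i).1.2) r
    simpa using hv⟩
  left_inv _ := rfl
  right_inv _ := rfl

end LinearAlgebra

/-- every solution of the critical system `L_B` over `F_q^n` extends to
exactly `q^{n(k − c(L) − m + m_B)}` solutions of `L`. -/
theorem card_extensions_of_critical_solution
    {F : Type} [Field F] [Fintype F] [DecidableEq F]
    {m k : ℕ} (hm : 2 ≤ m) (hmk : m ≤ k)
    (L : Matrix (Fin m) (Fin k) F) (hL : RowsIndep L)
    (B : Finset (Fin k)) (hB : IsCriticalSet L B)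
    (LB : Matrix (Fin (mMax L B)) (Fin B.card) F)
    (hLB : RowsIndep LB) (hLB' : InducesOn L LB B rfl)
    (n : ℕ) (hn : 1 ≤ n) (y : Fin B.card → Fin n → F)
    (hy : ∀ r, ∑ t, LB r t • y t = 0) :
    Nat.card {x : Fin k → Fin n → F //
        x ∈ solutions L n ∧ ∀ t, x (B.orderIsoOfFin rfl t).1 = y t} =
      Fintype.card F ^ (n * (k + mMax L B - (cEven L + m))) := by
  have hcard := hB.1
  have hfiber (i : Fin n) :
      Nat.card {v : LinearMap.ker L.mulVecLin // solutionRestrict L B v = fun t => y t i} =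
        Fintype.card F ^ (k + mMax L B - (cEven L + m)) := by
    have hyi : (fun t => y t i) ∈ LinearMap.range (solutionRestrict L B) := by
      rw [range_solutionRestrict_eq_ker hLB hLB', LinearMap.mem_ker]
      funext r
      simpa [Matrix.mulVec, dotProduct] using congrFun (hy r) i
    rw [LinearMap.natCard_fiber_of_mem_range _ hyi, Module.natCard_eq_pow_finrank (K := F),
      Nat.card_eq_fintype_card]
    congr 1
    have h₁ := (solutionRestrict L B).finrank_range_add_finrank_ker
    rw [range_solutionRestrict_eq_ker hLB hLB'] at h₁
    have h₂ := hL.finrank_ker_add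
    have h₃ := hLB.finrank_ker_add
    omega
  rw [Nat.card_congr (extensionsEquivPi L B y), Nat.card_pi,
    Finset.prod_congr rfl fun i _ => hfiber i, Finset.prod_const, Finset.card_univ,
    Fintype.card_fin, ← pow_mul, mul_comm]
end

section
/- Let q be a prime power and let 2 ≤ m < k be integers. Every irredundant (m×k)-system L over F_q with s(L) = 2 is uncommon. -/
open Finset

section Helpers

open Filter Topology

/-- Second-order expansion of `∏ (1/2 + δ g j)` in `δ`, with a continuous remainder. -/
lemma exists_continuous_prod_half_add_eq {ι : Type*} (s : Finset ι) (g : ι → ℝ) :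
    ∃ R : ℝ → ℝ, Continuous R ∧ ∀ δ : ℝ, ∏ j ∈ s, (1 / 2 + δ * g j) =
      (1 / 2) ^ s.card * (1 + 2 * δ * ∑ j ∈ s, g j
        + 2 * δ ^ 2 * ((∑ j ∈ s, g j) ^ 2 - ∑ j ∈ s, g j ^ 2)) + δ ^ 3 * R δ := by
  classical
  induction s using Finset.induction_on with
  | empty => exact ⟨fun _ => 0, continuous_const, fun δ => by simp⟩
  | insert a s ha ih =>
    obtain ⟨R, hR, h⟩ := ih
    refine ⟨fun δ => (1 / 2 + δ * g a) * R δ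
      + (1 / 2) ^ s.card * 2 * g a * ((∑ j ∈ s, g j) ^ 2 - ∑ j ∈ s, g j ^ 2), by fun_prop, ?_⟩
    intro δ
    rw [prod_insert ha, h, card_insert_of_notMem ha, sum_insert ha, sum_insert ha]
    ring

/-- If the second-order coefficient is negative, then the symmetrised sum of products drops below
its value at `0` for some small perturbation. -/
lemma exists_sum_prod_half_add_lt {α ι : Type*} [Fintype ι] (S : Finset α) (g : α → ι → ℝ)
    (hneg : ∑ x ∈ S, ((∑ j, g x j) ^ 2 - ∑ j, g x j ^ 2) < 0) :
    ∃ δ : ℝ, 0 < δ ∧ δ < 1 / 2 ∧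
      ∑ x ∈ S, ∏ j, (1 / 2 + δ * g x j) + ∑ x ∈ S, ∏ j, (1 / 2 - δ * g x j) <
        2 * (1 / 2) ^ Fintype.card ι * S.card := by
  choose R hR h using fun x => exists_continuous_prod_half_add_eq Finset.univ (g x)
  set E := ∑ x ∈ S, ((∑ j, g x j) ^ 2 - ∑ j, g x j ^ 2) with hE
  set c : ℝ := (1 / 2) ^ Fintype.card ι with hc
  have hcpos : 0 < c := by positivity
  have hcont : Continuous fun δ : ℝ =>
      4 * c * E + δ * ∑ x ∈ S, (R x δ - R x (-δ)) := by
    have := fun x => (hR x).comp continuous_neg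
    simp only [Function.comp_def] at this
    fun_prop
  have hlim := hcont.tendsto 0
  have hlt : ∀ᶠ δ in 𝓝 (0 : ℝ), 4 * c * E + δ * ∑ x ∈ S, (R x δ - R x (-δ)) < 0 := by
    refine hlim.eventually_lt_const ?_
    have : 0 < c * -E := mul_pos hcpos (neg_pos.mpr hneg)
    linarith
  obtain ⟨δ, hδ, hδ0, hδ1⟩ := ((hlt.filter_mono nhdsWithin_le_nhds).and
    (Ioo_mem_nhdsGT (show (0 : ℝ) < 1 / 2 by norm_num))).exists
  refine ⟨δ, hδ0, hδ1, ?_⟩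
  have key : ∑ x ∈ S, ∏ j, (1 / 2 + δ * g x j) + ∑ x ∈ S, ∏ j, (1 / 2 - δ * g x j) =
      2 * c * S.card + δ ^ 2 * (4 * c * E + δ * ∑ x ∈ S, (R x δ - R x (-δ))) := by
    have hx : ∀ x ∈ S, ∏ j, (1 / 2 + δ * g x j) + ∏ j, (1 / 2 - δ * g x j) =
        2 * c + (δ ^ 2 * 4 * c * ((∑ j, g x j) ^ 2 - ∑ j, g x j ^ 2)
          + δ ^ 3 * (R x δ - R x (-δ))) := by
      intro x _
      have h' := h x (-δ)
      simp only [neg_mul, ← sub_eq_add_neg] at h'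
      rw [h, h', Finset.card_univ, ← hc]
      ring
    rw [← sum_add_distrib, sum_congr rfl hx, sum_add_distrib, sum_add_distrib, sum_const,
      nsmul_eq_mul, ← mul_sum, ← mul_sum, ← hE]
    ring
  rw [key]
  have := mul_neg_of_pos_of_neg (pow_pos hδ0 2) hδ
  linarith

variable {F : Type} [Field F] [DecidableEq F]

/-- The difference of the point masses at `1` and at `b`. -/
def pointDiff (b y : F) : ℝ := (if y = 1 then 1 else 0) - (if y = b then 1 else 0)

lemma pointDiff_mem_Icc (b y : F) : pointDiff b y ∈ Set.Icc (-1 : ℝ) 1 := by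
  unfold pointDiff
  constructor <;> split_ifs <;> norm_num

lemma pointDiff_mul_pointDiff_nonpos {b y z : F} (h1 : ¬ (y = 1 ∧ z = 1))
    (hb : ¬ (y = b ∧ z = b)) : pointDiff b y * pointDiff b z ≤ 0 := by
  unfold pointDiff
  split_ifs <;> simp_all

variable {k : ℕ} (V : Submodule F (Fin k → F)) [Fintype V]

lemma sum_pointDiff_mul_neg {b : F} (hb : b ≠ 0) (hb1 : b ≠ 1) {i j : Fin k}
    (hij : ∀ x ∈ V, x i = b * x j) (hj : ∃ x ∈ V, x j ≠ 0) :
    ∑ x : V, pointDiff b (x.1 i) * pointDiff b (x.1 j) < 0 := by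
  obtain ⟨y, hy, hyj⟩ := hj
  refine sum_neg' (fun x _ => ?_) ⟨⟨(y j)⁻¹ • y, V.smul_mem _ hy⟩, mem_univ _, ?_⟩
  · have hx := hij x x.2
    apply pointDiff_mul_pointDiff_nonpos
    · rintro ⟨h1, h2⟩
      exact hb1 (by simpa [h1, h2] using hx.symm)
    · rintro ⟨h1, h2⟩
      exact hb1 (by simpa [h1, h2, hb] using hx)
  · have : (y j)⁻¹ * y i = b := by
      rw [hij y hy]
      field_simp
    simp [pointDiff, this, hyj, hb1, hb1.symm]

variable [Fintype F]

lemma sum_pointDiff (b : F) : ∑ y, pointDiff b y = 0 := by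
  simp [pointDiff]

lemma sum_pointDiff_mul_eq_zero {b : F} {i j : Fin k} {d : Fin k → F}
    (hd : d ∈ V) (hi : d i = 0) (hj : d j ≠ 0) :
    ∑ x : V, pointDiff b (x.1 i) * pointDiff b (x.1 j) = 0 := by
  have hshift : ∀ t : F, ∑ x : V, pointDiff b (x.1 i) * pointDiff b (x.1 j) =
      ∑ x : V, pointDiff b (x.1 i) * pointDiff b (x.1 j + t * d j) := by
    intro t
    rw [← Equiv.sum_comp (Equiv.addRight (t • (⟨d, hd⟩ : V)))]
    simp [hi]
  have hinner : ∀ a : F, ∑ t : F, pointDiff b (a + t * d j) = 0 := by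
    intro a
    rw [← sum_pointDiff b]
    exact Equiv.sum_comp ((Equiv.mulRight₀ (d j) hj).trans (Equiv.addLeft a)) (pointDiff b)
  have htotal : ∑ _t : F, ∑ x : V, pointDiff b (x.1 i) * pointDiff b (x.1 j) = 0 := by
    rw [sum_congr rfl fun t _ => hshift t, sum_comm]
    simp [← mul_sum, hinner]
  simpa using htotal

lemma sum_pointDiff_mul_nonpos {b : F} (hb : b ≠ 0) {i j : Fin k}
    (hij : ∃ x ∈ V, x i ≠ x j) :
    ∑ x : V, pointDiff b (x.1 i) * pointDiff b (x.1 j) ≤ 0 := by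
  by_cases hd : ∃ d ∈ V, d i = 0 ∧ d j ≠ 0
  · obtain ⟨d, hd, hi, hj⟩ := hd
    exact (sum_pointDiff_mul_eq_zero V hd hi hj).le
  push Not at hd
  obtain ⟨y, hy, hyij⟩ := hij
  have hne : ∀ x ∈ V, ∀ a : F, a ≠ 0 → ¬ (x i = a ∧ x j = a) := by
    rintro x hx a ha ⟨hxi, hxj⟩
    have h := hd (y - (y i / a) • x) (V.sub_mem hy (V.smul_mem _ hx)) (by simp [hxi, ha])
    simp only [Pi.sub_apply, Pi.smul_apply, smul_eq_mul, hxj, div_mul_cancel₀ _ ha] at h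
    exact hyij (sub_eq_zero.mp h).symm
  exact sum_nonpos fun x _ =>
    pointDiff_mul_pointDiff_nonpos (hne x x.2 1 one_ne_zero) (hne x x.2 b hb)

/-- The second-order coefficient is negative as soon as some two distinct coordinates are
proportional, and no two distinct coordinates agree on `V`. -/
lemma sum_sq_sum_sub_sum_sq_neg {b : F} (hb : b ≠ 0) (hb1 : b ≠ 1) {i j : Fin k}
    (hne : i ≠ j) (hij : ∀ x ∈ V, x i = b * x j) (hj : ∃ x ∈ V, x j ≠ 0)
    (hirr : ∀ i j : Fin k, i ≠ j → ∃ x ∈ V, x i ≠ x j) :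
    ∑ x : V, ((∑ l, pointDiff b (x.1 l)) ^ 2 - ∑ l, pointDiff b (x.1 l) ^ 2) < 0 := by
  have hoff : ∀ x : V, (∑ l, pointDiff b (x.1 l)) ^ 2 - ∑ l, pointDiff b (x.1 l) ^ 2 =
      ∑ p ∈ (univ : Finset (Fin k)).offDiag, pointDiff b (x.1 p.1) * pointDiff b (x.1 p.2) := by
    intro x
    rw [sub_eq_iff_eq_add, sq, sum_mul_sum, ← sum_product', ← diag_union_offDiag,
      sum_union (disjoint_diag_offDiag _), sum_diag, add_comm]
    simp [sq]
  simp only [hoff]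
  rw [sum_comm]
  refine sum_neg' (fun p hp => ?_) ⟨(i, j), by simpa using hne, ?_⟩
  · exact sum_pointDiff_mul_nonpos V hb (hirr _ _ (by simpa using hp))
  · exact sum_pointDiff_mul_neg V hb hb1 hij hj

/-- A system with `s(L) = 2` relates two coordinates by a nonzero factor, and forces no
coordinate to vanish. -/
lemma exists_proportional_of_sMin_eq_two {m : ℕ} {L : Matrix (Fin m) (Fin k) F}
    (hs : sMin L = 2) :
    (∃ (i j : Fin k) (b : F), i ≠ j ∧ b ≠ 0 ∧
      ∀ x : Fin k → F, (∀ r, ∑ t, L r t * x t = 0) → x i = b * x j) ∧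
    ∀ j : Fin k, ∃ x : Fin k → F, (∀ r, ∑ t, L r t * x t = 0) ∧ x j ≠ 0 := by
  constructor
  · have hmem := Nat.sInf_mem (Nat.nonempty_of_pos_sInf (by
      change 0 < sMin L
      omega) : {s | ∃ c : Fin k → F, c ≠ 0 ∧ InducedEq L c ∧ eqLength c = s}.Nonempty)
    obtain ⟨c, -, hc, hlen⟩ := hmem
    change eqLength c = sMin L at hlen
    rw [hs, eqLength, card_eq_two] at hlen
    obtain ⟨i, j, hij, hsupp⟩ := hlen
    have hci : c i ≠ 0 := by
      have : i ∈ univ.filter fun j => c j ≠ 0 := by simp [hsupp]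
      simpa using this
    have hcj : c j ≠ 0 := by
      have : j ∈ univ.filter fun j => c j ≠ 0 := by simp [hsupp]
      simpa using this
    refine ⟨i, j, -c j / c i, hij, div_ne_zero (neg_ne_zero.mpr hcj) hci, fun x hx => ?_⟩
    have h := hc x hx
    rw [← sum_filter_of_ne (p := fun j => c j ≠ 0) (fun _ _ => left_ne_zero_of_mul), hsupp,
      sum_pair hij] at h
    field_simp
    linear_combination h
  · intro j
    by_contra! hj
    refine Nat.notMem_of_lt_sInf (m := 1) (s := {s | ∃ c : Fin k → F, c ≠ 0 ∧ InducedEq L c ∧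
      eqLength c = s}) (by change 1 < sMin L; omega) ⟨Pi.single j 1, by simp, ?_, ?_⟩
    · intro x hx
      simp [Pi.single_apply, hj x hx]
    · simp [eqLength, Pi.single_apply, filter_eq']

/-- Sums over the solutions in `F ^ 1` are sums over the kernel of `L`. -/
lemma sum_solutions_one {m : ℕ} (L : Matrix (Fin m) (Fin k) F)
    [Fintype (LinearMap.ker L.mulVecLin)] (φ : (Fin k → F) → ℝ) :
    ∑ x ∈ solutions L 1, φ (fun j => x j 0) = ∑ v : LinearMap.ker L.mulVecLin, φ v.1 := by
  have hmem : ∀ x : Fin k → Fin 1 → F,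
      x ∈ solutions L 1 ↔ (fun j => x j 0) ∈ LinearMap.ker L.mulVecLin := by
    intro x
    simp [solutions, funext_iff, Matrix.mulVec, dotProduct, Finset.sum_apply]
  refine sum_bij' (fun x hx => ⟨fun j => x j 0, (hmem x).1 hx⟩) (fun v _ j _ => v.1 j)
    (fun _ _ => mem_univ _) (fun v _ => (hmem _).2 v.2) ?_ (fun _ _ => rfl) (fun _ _ => rfl)
  intro x _
  funext j t
  rw [Subsingleton.elim t 0]

end Helpers

/-- every irredundant `(m × k)`-system with `s(L) = 2` is uncommon. -/
theorem uncommon_of_sMin_eq_two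
    {F : Type} [Field F] [Fintype F] [DecidableEq F]
    {m k : ℕ} (hm : 2 ≤ m) (hmk : m < k)
    (L : Matrix (Fin m) (Fin k) F) (hL : RowsIndep L)
    (hirr : IsIrredundant L) (hs : sMin L = 2) :
    ¬ IsCommon L := by
  classical
  obtain ⟨⟨i, j, b, hij, hb, hprop⟩, hnz⟩ := exists_proportional_of_sMin_eq_two hs
  have hmem : ∀ x : Fin k → F,
      x ∈ LinearMap.ker L.mulVecLin ↔ ∀ r, ∑ t, L r t * x t = 0 := by
    intro x
    simp [funext_iff, Matrix.mulVec, dotProduct]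
  have hirr' : ∀ i j : Fin k, i ≠ j → ∃ x ∈ LinearMap.ker L.mulVecLin, x i ≠ x j := by
    intro i j hne
    by_contra! h
    exact hirr ⟨i, j, hne, fun x hx => h x ((hmem x).2 hx)⟩
  have hb1 : b ≠ 1 := by
    rintro rfl
    exact hirr ⟨i, j, hij, fun x hx => by simpa using hprop x hx⟩
  obtain ⟨y, hy, hyj⟩ := hnz j
  have hneg := sum_sq_sum_sub_sum_sq_neg (LinearMap.ker L.mulVecLin) hb hb1 hij
    (fun x hx => hprop x ((hmem x).1 hx)) ⟨y, (hmem y).2 hy, hyj⟩ hirr'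
  rw [← sum_solutions_one L
    (fun v => (∑ l, pointDiff b (v l)) ^ 2 - ∑ l, pointDiff b (v l) ^ 2)] at hneg
  obtain ⟨δ, hδ0, hδ1, hlt⟩ :=
    exists_sum_prod_half_add_lt (solutions L 1)
      (fun (x : Fin k → Fin 1 → F) (j : Fin k) => pointDiff b (x j 0)) hneg
  intro hcommon
  have hcard : (0 : ℝ) < (solutions L 1).card := by
    exact_mod_cast card_pos.mpr ⟨0, by simp [solutions]⟩
  have h := hcommon 1 le_rfl (fun y => δ * pointDiff b (y 0)) fun y => by
    obtain ⟨h1, h2⟩ := pointDiff_mem_Icc b (y 0)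
    constructor <;> nlinarith
  rw [deltaSol, lambdaSol, lambdaSol, ← add_div, le_div_iff₀ hcard] at h
  rw [Fintype.card_fin] at hlt
  have hpow : (2 : ℝ) ^ (1 - (k : ℤ)) = 2 * (1 / 2) ^ k := by
    rw [zpow_sub₀ two_ne_zero]
    simp [div_eq_mul_inv]
  rw [hpow] at h
  exact absurd hlt (not_lt.mpr h)
end
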